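/- arXiv:1504.04422 — 3 statements merged into one kernel-verified Lean document; each statement's English description precedes it below -/
import Mathlib

section
/- Let Γ be a finite connected non-complete graph of prime valency p that is 2-geodesic transitive but not 2-arc transitive. Then for every 2-geodesic (v,u,w) of Γ, the number of common neighbours of v and w equals (p-1)/2. -/
open SimpleGraph

/-- `Γ` is arc transitive: its automorphism group is transitive on ordered pairs
of adjacent vertices. -/
def ArcTransitive {V : Type*} (Γ : SimpleGraph V) : Prop :=
  ∀ ⦃v u v' u' : V⦄, Γ.Adj v u → Γ.Adj v' u' →
    ∃ φ : Γ ≃g Γ, φ v = v' ∧ φ u = u'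

/-- `(v,u,w)` is a 2-arc of `Γ`. -/
def Is2Arc {V : Type*} (Γ : SimpleGraph V) (v u w : V) : Prop :=
  Γ.Adj v u ∧ Γ.Adj u w ∧ v ≠ w

/-- `(v,u,w)` is a 2-geodesic of `Γ`: a 2-arc with `v`, `w` non-adjacent. -/
def Is2Geodesic {V : Type*} (Γ : SimpleGraph V) (v u w : V) : Prop :=
  Γ.Adj v u ∧ Γ.Adj u w ∧ v ≠ w ∧ ¬ Γ.Adj v w

/-- `Γ` is 2-arc transitive: arc transitive and transitive on 2-arcs. -/
def TwoArcTransitive {V : Type*} (Γ : SimpleGraph V) : Prop :=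
  ArcTransitive Γ ∧
  ∀ ⦃v u w v' u' w' : V⦄, Is2Arc Γ v u w → Is2Arc Γ v' u' w' →
    ∃ φ : Γ ≃g Γ, φ v = v' ∧ φ u = u' ∧ φ w = w'

/-- `Γ` is 2-geodesic transitive: arc transitive and transitive on 2-geodesics. -/
def TwoGeodesicTransitive {V : Type*} (Γ : SimpleGraph V) : Prop :=
  ArcTransitive Γ ∧
  ∀ ⦃v u w v' u' w' : V⦄, Is2Geodesic Γ v u w → Is2Geodesic Γ v' u' w' →
    ∃ φ : Γ ≃g Γ, φ v = v' ∧ φ u = u' ∧ φ w = w'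

open Polynomial in
/-- Some power sum of exponent between 1 and `S.card` of a nonempty set `S` of nonzero field
elements does not vanish. -/
theorem exists_powerSum_ne_zero {F : Type*} [Field F] [DecidableEq F] {S : Finset F}
    (h0 : (0 : F) ∉ S) (hne : S.Nonempty) : ∃ m, 1 ≤ m ∧ m ≤ S.card ∧ ∑ s ∈ S, s ^ m ≠ 0 := by
  obtain ⟨t, ht⟩ := hne
  by_contra! h
  set q : F[X] := X * ∏ s ∈ S.erase t, (X - C s) with hq
  have hdeg : q.natDegree < S.card + 1 := by
    have h1 : q.natDegree ≤ 1 + (S.erase t).card := by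
      refine natDegree_mul_le.trans ?_
      rw [natDegree_X, natDegree_prod_of_monic _ _ fun s _ => monic_X_sub_C s]
      simp
    rw [Finset.card_erase_of_mem ht] at h1
    have := Finset.card_pos.2 ⟨t, ht⟩
    omega
  have h1 : ∑ s ∈ S, q.eval s = q.eval t := by
    refine Finset.sum_eq_single_of_mem t ht fun s hs hst => ?_
    rw [hq, eval_mul, eval_prod, Finset.prod_eq_zero (Finset.mem_erase.2 ⟨hst, hs⟩) (by simp),
      mul_zero]
  have h2 : ∑ s ∈ S, q.eval s = 0 := by
    simp_rw [eval_eq_sum_range' hdeg]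
    rw [Finset.sum_comm]
    refine Finset.sum_eq_zero fun m hm => ?_
    rw [← Finset.mul_sum]
    rcases Nat.eq_zero_or_pos m with rfl | hm0
    · simp [hq]
    · rw [h m hm0 (by simpa [Nat.lt_succ_iff] using hm), mul_zero]
  rw [h2] at h1
  have h3 : q.eval t ≠ 0 := by
    rw [hq, eval_mul, eval_prod, eval_X]
    refine mul_ne_zero (fun h => h0 (h ▸ ht)) (Finset.prod_ne_zero_iff.2 fun s hs => ?_)
    simpa [sub_eq_zero] using (Finset.ne_of_mem_erase hs).symm
  exact h3 h1.symm

open Polynomial in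
/-- An injection of `ZMod p` that preserves the relation `y - x ∈ S`, where `S` is a nonempty set of
at most `(p - 1) / 2` nonzero elements with sum zero, is affine. -/
theorem affine_of_preserves_differences {p : ℕ} [Fact p.Prime] {S : Finset (ZMod p)}
    (h0 : 0 ∉ S) (hne : S.Nonempty) (hsum : ∑ s ∈ S, s = 0) (hcard : 2 * S.card ≤ p - 1)
    {g : ZMod p → ZMod p} (hinj : Function.Injective g)
    (hg : ∀ x, ∀ s ∈ S, g (x + s) - g x ∈ S) : ∃ a b, ∀ x, g x = a * x + b := by
  classical
  have hp : p.Prime := Fact.out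
  have hex := exists_powerSum_ne_zero h0 hne
  let P : ℕ → Prop := fun m => 1 ≤ m ∧ ∑ s ∈ S, s ^ m ≠ 0
  have hP : ∃ m, P m := let ⟨m, h1, _, h2⟩ := hex; ⟨m, h1, h2⟩
  obtain ⟨d, ⟨hd1, hd⟩, hmin, hdS⟩ : ∃ d, P d ∧ (∀ m, 1 ≤ m → m < d → ∑ s ∈ S, s ^ m = 0) ∧
      d ≤ S.card := by
    refine ⟨Nat.find hP, Nat.find_spec hP, fun m h1 h2 => ?_, ?_⟩
    · by_contra h
      exact Nat.find_min hP h2 ⟨h1, h⟩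
    · obtain ⟨m, h1, h2, h3⟩ := hex
      exact (Nat.find_min' hP ⟨h1, h3⟩).trans h2
  have hd2 : 2 ≤ d := by
    by_contra h
    obtain rfl : d = 1 := by omega
    simp [hsum] at hd
  obtain ⟨Q, hQdeg, hQ⟩ : ∃ Q : (ZMod p)[X], Q.natDegree < p ∧ ∀ x, Q.eval x = g x := by
    refine ⟨Lagrange.interpolate Finset.univ id g, ?_, fun x => ?_⟩
    · have := Lagrange.degree_interpolate_lt (s := Finset.univ) (v := id) g
        (Function.injective_id.injOn)
      rw [Finset.card_univ, ZMod.card] at this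
      by_cases h : Lagrange.interpolate Finset.univ id g = 0
      · simpa [h] using hp.pos
      · exact (natDegree_lt_iff_degree_lt h).2 this
    · exact Lagrange.eval_interpolate_at_node (v := id) g Function.injective_id.injOn
        (Finset.mem_univ x)
  set n := Q.natDegree with hn
  have hshift (x : ZMod p) (f : ZMod p → ZMod p) :
      ∑ s ∈ S, f (g (x + s) - g x) = ∑ s ∈ S, f s := by
    have hi : Set.InjOn (fun s => g (x + s) - g x) S := fun s _ t _ h => by
      simpa using hinj (sub_left_injective h)
    have him : S.image (fun s => g (x + s) - g x) = S :=
      Finset.eq_of_subset_of_card_le (Finset.image_subset_iff.2 (hg x))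
        (Finset.card_image_of_injOn hi).ge
    conv_rhs => rw [← him]
    rw [Finset.sum_image hi]
  have key (m : ℕ) (hmd : m < d) (hmn : m * n < p) : m * n < d := by
    by_contra! hdn
    have hQm : (Q ^ m).natDegree = m * n := natDegree_pow Q m
    have hzero : ∑ s ∈ S, taylor s (Q ^ m) - (S.card : (ZMod p)[X]) * Q ^ m = 0 := by
      refine eq_zero_of_natDegree_lt_card_of_eval_eq_zero _ (Function.injective_id) (fun x => ?_) ?_
      · have h1 : ∑ s ∈ S, g (x + s) ^ m = S.card * g x ^ m := by
          have := hshift x fun y => (y + g x) ^ m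
          simp only [sub_add_cancel] at this
          rw [this]
          simp_rw [add_pow]
          rw [Finset.sum_comm, Finset.sum_eq_single_of_mem 0 (by simp)]
          · simp
          · intro j hj hj0
            simp_rw [← Finset.sum_mul]
            rw [hmin j (by omega) (by have := Finset.mem_range.1 hj; omega)]
            simp
        simp only [id, eval_sub, eval_finsetSum, taylor_eval, eval_pow, eval_mul, eval_natCast, hQ]
        rw [← h1, sub_eq_zero]
      · rw [ZMod.card]
        refine lt_of_le_of_lt ?_ hmn
        refine (natDegree_sub_le _ _).trans
          (max_le (natDegree_sum_le_of_forall_le _ _ fun s _ => ?_) ?_)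
        · rw [natDegree_taylor, hQm]
        · rw [← hQm]
          refine natDegree_mul_le.trans ?_
          simp
    have hc := congrArg (fun f => coeff f (m * n - d)) hzero
    have hco (s : ZMod p) : (taylor s (Q ^ m)).coeff (m * n - d) =
        ∑ j ∈ Finset.range (d + 1),
          ((m * n - d + j).choose (m * n - d) : ZMod p) * (Q ^ m).coeff (m * n - d + j) * s ^ j := by
      rw [taylor_coeff, eval_eq_sum_range' (n := d + 1)]
      · refine Finset.sum_congr rfl fun j _ => ?_
        rw [hasseDeriv_coeff, add_comm j]
      · have := natDegree_hasseDeriv_le (Q ^ m) (m * n - d)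
        omega
    simp only [coeff_sub, finsetSum_coeff, hco, coeff_zero] at hc
    rw [Finset.sum_comm] at hc
    simp_rw [← Finset.mul_sum] at hc
    rw [Finset.sum_range_succ, Finset.sum_eq_single_of_mem 0 (by simp; omega), ← C_eq_natCast,
      coeff_C_mul] at hc
    · simp only [add_zero, Nat.choose_self, Nat.cast_one, one_mul, pow_zero, Finset.sum_const,
        nsmul_eq_mul, mul_one] at hc
      rw [mul_comm, add_sub_cancel_left, Nat.sub_add_cancel hdn, ← hQm, coeff_natDegree] at hc
      have hQ0 : (Q ^ m).leadingCoeff ≠ 0 := by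
        rw [leadingCoeff_ne_zero]
        intro h
        rw [h, natDegree_zero] at hQm
        omega
      have hch : ((Q ^ m).natDegree.choose ((Q ^ m).natDegree - d) : ZMod p) ≠ 0 := by
        rw [Ne, ZMod.natCast_eq_zero_iff, hQm]
        intro h
        have h2 := (h.mul_right _).mul_right _ |>.trans
          (Nat.choose_mul_factorial_mul_factorial (Nat.sub_le (m * n) d)).dvd
        rw [hp.dvd_factorial] at h2
        omega
      exact mul_ne_zero (mul_ne_zero hch hQ0) hd hc
    · intro j hj hj0
      rw [hmin j (by omega) (by simpa using hj), mul_zero]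
  have hn1 : n ≤ 1 := by
    by_contra! hn2
    have h1 := key 1 (by omega) (by omega)
    have h2 : (d - 1) / n * n ≤ d - 1 := Nat.div_mul_le_self _ _
    have h3 : d - 1 < (d - 1) / n * n + n := Nat.lt_div_mul_add (by omega)
    have h4 : (d - 1) / n ≤ (d - 1) / 2 := Nat.div_le_div_left hn2 (by omega)
    have h5 : ((d - 1) / n + 1) * n = (d - 1) / n * n + n := by ring
    have h6 := key ((d - 1) / n + 1) (by omega) (by omega)
    omega
  obtain ⟨a, b, hab⟩ := exists_eq_X_add_C_of_natDegree_le_one hn1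
  exact ⟨a, b, fun x => by rw [← hQ, hab]; simp⟩

/-- A graph isomorphism maps common neighbourhoods to common neighbourhoods. -/
theorem SimpleGraph.Iso.ncard_commonNeighbors {V W : Type*} {G : SimpleGraph V}
    {G' : SimpleGraph W} (f : G ≃g G') (a b : V) :
    (G'.commonNeighbors (f a) (f b)).ncard = (G.commonNeighbors a b).ncard := by
  have : G'.commonNeighbors (f a) (f b) = f '' G.commonNeighbors a b := by
    ext x
    obtain ⟨x, rfl⟩ := f.surjective x
    simp [mem_commonNeighbors, f.map_adj_iff]
  rw [this, Set.ncard_image_of_injective _ f.injective]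

theorem SimpleGraph.Iso.ncard_neighborSet {V W : Type*} {G : SimpleGraph V}
    {G' : SimpleGraph W} (f : G ≃g G') (a : V) :
    (G'.neighborSet (f a)).ncard = (G.neighborSet a).ncard := by
  simpa [commonNeighbors] using f.ncard_commonNeighbors a a

/-- In a regular self-complementary arc-transitive graph, twice the number of vertices outside an
edge that are adjacent to neither of its ends is the valency. -/
theorem two_mul_ncard_commonNeighbors_compl {V : Type*} [Finite V] {R : SimpleGraph V} {n : ℕ}
    (hn : 0 < n) (hreg : ∀ x, (R.neighborSet x).ncard = n)
    (hR : ArcTransitive R) (σ : R ≃g Rᶜ) {a b : V} (hab : R.Adj a b) :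
    2 * (Rᶜ.commonNeighbors a b).ncard = n := by
  classical
  have := Fintype.ofFinite V
  have hdeg (x : V) : R.degree x = n := by
    rw [← hreg x, Set.ncard_eq_toFinset_card', ← card_neighborFinset_eq_degree]; rfl
  have hadj (x y : V) (h : R.Adj x y) :
      Fintype.card (R.commonNeighbors x y) = (R.commonNeighbors a b).ncard := by
    obtain ⟨φ, rfl, rfl⟩ := hR hab h
    rw [← φ.ncard_commonNeighbors, Set.ncard_eq_toFinset_card', Set.toFinset_card]
  have hnadj : Pairwise fun x y => ¬ R.Adj x y →
      Fintype.card (R.commonNeighbors x y) = (R.commonNeighbors (σ a) (σ b)).ncard := by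
    intro x y hxy h
    obtain ⟨x, rfl⟩ := σ.surjective x
    obtain ⟨y, rfl⟩ := σ.surjective y
    have h' : R.Adj x y := by
      rw [← σ.map_adj_iff]
      exact (compl_adj ..).2 ⟨hxy, h⟩
    obtain ⟨φ, rfl, rfl⟩ := hR hab h'
    have hσ (x y : V) : Rᶜ.Adj (σ x) (σ y) ↔ R.Adj x y := σ.map_adj_iff
    let e : R ≃g R :=
      { toEquiv := (σ.symm.toEquiv.trans φ.toEquiv).trans σ.toEquiv
        map_rel_iff' := by
          intro x y
          obtain ⟨x, rfl⟩ := σ.surjective x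
          obtain ⟨y, rfl⟩ := σ.surjective y
          have h1 := hσ x y
          have h2 := hσ (φ x) (φ y)
          rw [φ.map_adj_iff, ← h1] at h2
          simp only [compl_adj, ne_eq, σ.injective.eq_iff, φ.injective.eq_iff] at h2
          by_cases hxy : x = y
          · simp [hxy]
          · simpa [hxy, not_iff_not] using h2 }
    have he (x : V) : e (σ x) = σ (φ x) := by
      change σ (φ (σ.symm (σ x))) = _
      rw [RelIso.symm_apply_apply]
    rw [← e.ncard_commonNeighbors, he, he, Set.ncard_eq_toFinset_card', Set.toFinset_card]
  have hsrg : R.IsSRGWith (Fintype.card V) n _ _ := ⟨rfl, hdeg, hadj, hnadj⟩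
  have h1 := hsrg.param_eq R (Fintype.card_pos_iff.2 ⟨a⟩)
  have h2 := hsrg.compl
  have hdeg' := h2.regular (σ a)
  have hn' := σ.ncard_neighborSet a
  rw [hreg, Set.ncard_eq_toFinset_card'] at hn'
  have hn'' : Rᶜ.degree (σ a) = n := hn'
  have h3 := h2.of_adj _ _ (σ.map_adj_iff.2 hab)
  have h4 := h2.of_not_adj hab.ne (by simp [hab])
  rw [← Set.toFinset_card, ← Set.ncard_eq_toFinset_card'] at h3 h4
  rw [σ.ncard_commonNeighbors] at h3
  have hsum := R.sum_degrees_eq_twice_card_edges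
  simp only [hdeg, Finset.sum_const, Finset.card_univ, smul_eq_mul] at hsum
  generalize (R.commonNeighbors (σ a) (σ b)).ncard = m at *
  generalize (R.commonNeighbors a b).ncard = l at *
  have hc : Fintype.card V = 2 * n + 1 := by omega
  rw [hc, show 2 * n + 1 - n - 1 = n by omega] at h1
  have h5 := Nat.eq_of_mul_eq_mul_left hn h1
  by_cases hn1 : n = 1
  · subst hn1
    omega
  · omega

/-- Automorphisms of a circulant graph of prime order are affine, unless the graph is complete
or empty. -/
theorem affine_of_circulant_iso {p : ℕ} [Fact p.Prime] {R : SimpleGraph (ZMod p)}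
    (hadj : ∀ x y, R.Adj x y ↔ R.Adj 0 (y - x)) (hbot : R ≠ ⊥) (htop : R ≠ ⊤) (φ : R ≃g R) :
    ∃ a b, ∀ x, φ x = a * x + b := by
  classical
  have hneg (z : ZMod p) : R.Adj 0 (-z) ↔ R.Adj 0 z := by
    rw [R.adj_comm 0 z, hadj z 0, zero_sub]
  let S : Finset (ZMod p) := {z | R.Adj 0 z}
  let T : Finset (ZMod p) := {z | z ≠ 0 ∧ ¬ R.Adj 0 z}
  have hST : S.card + T.card = p - 1 := by
    have hd : Disjoint S T := by
      rw [Finset.disjoint_left]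
      simp +contextual [S, T]
    have hu : S ∪ T = Finset.univ.erase 0 := by
      ext z
      simp only [S, T, Finset.mem_union, Finset.mem_filter_univ, Finset.mem_erase,
        Finset.mem_univ, and_true]
      have : R.Adj 0 z → z ≠ 0 := fun h => h.ne'
      tauto
    rw [← Finset.card_union_of_disjoint hd, hu, Finset.card_erase_of_mem (Finset.mem_univ _),
      Finset.card_univ, ZMod.card]
  have hS : S.Nonempty := by
    obtain ⟨x, y, h⟩ := ne_bot_iff_exists_adj.1 hbot
    exact ⟨y - x, by simpa [S] using (hadj x y).1 h⟩
  have hT : T.Nonempty := by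
    obtain ⟨x, y, hne, h⟩ := ne_top_iff_exists_not_adj.1 htop
    exact ⟨y - x, by simpa [T, sub_eq_zero, hne.symm] using (hadj x y).not.1 h⟩
  have hφ (x z : ZMod p) : R.Adj 0 (φ (x + z) - φ x) ↔ R.Adj 0 z := by
    rw [← hadj, φ.map_adj_iff, hadj, add_sub_cancel_left]
  have h2 : (2 : ZMod p) ≠ 0 := by
    have := hS.card_pos
    have := hT.card_pos
    intro h
    have := Nat.le_of_dvd two_pos ((ZMod.natCast_eq_zero_iff 2 p).1 (by exact_mod_cast h))
    omega
  have hsum (U : Finset (ZMod p)) (hU : ∀ z ∈ U, -z ∈ U) : ∑ z ∈ U, z = 0 := by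
    refine Finset.sum_involution (fun z _ => -z) (by simp) (fun z _ hz h => hz ?_) hU (by simp)
    have : 2 * z = 0 := by rw [two_mul]; nth_rewrite 1 [← h]; simp
    exact (mul_eq_zero.1 this).resolve_left h2
  rcases le_total S.card T.card with h | h
  · refine affine_of_preserves_differences (S := S) (by simp [S]) hS
      (hsum S fun z hz => ?_) (by omega) φ.injective fun x s hs => ?_
    · simpa [S, hneg] using hz
    · simpa [S, hφ] using hs
  · refine affine_of_preserves_differences (S := T) (by simp [T]) hT
      (hsum T fun z hz => ?_) (by omega) φ.injective fun x s hs => ?_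
    · simpa [T, hneg] using hz
    · simpa [T, hφ, sub_eq_zero, φ.injective.eq_iff] using hs

/-- If adjacency-or-equality is transitive in a nonempty circulant graph of prime order, then
the graph is complete. -/
theorem exists_two_path_of_circulant {p : ℕ} [Fact p.Prime] {R : SimpleGraph (ZMod p)}
    (hadj : ∀ x y, R.Adj x y ↔ R.Adj 0 (y - x)) (hbot : R ≠ ⊥) (htop : R ≠ ⊤) :
    ∃ a b c, R.Adj a b ∧ R.Adj b c ∧ a ≠ c ∧ ¬ R.Adj a c := by
  by_contra! h
  obtain ⟨x, y, hxy⟩ := ne_bot_iff_exists_adj.1 hbot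
  have hs := (hadj x y).1 hxy
  set s := y - x
  have hk (k : ℕ) : (k : ZMod p) * s ≠ 0 → R.Adj 0 (k * s) := by
    induction k with
    | zero => simp
    | succ k ih =>
      intro hne
      by_cases h0 : (k : ZMod p) * s = 0
      · simpa [add_mul, h0] using hs
      · refine h _ _ _ (ih h0) ?_ hne.symm
        rw [hadj]
        simpa [add_mul] using hs
  obtain ⟨u, v, huv, hn⟩ := ne_top_iff_exists_not_adj.1 htop
  rw [hadj] at hn
  have := hk ((v - u) / s).val
  rw [ZMod.natCast_zmod_val, div_mul_cancel₀ _ hs.ne'] at this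
  exact hn (this (sub_ne_zero.2 huv.symm))

/-- The connection set of an arc-transitive circulant graph of prime order is, up to scaling, a
multiplicative subgroup. -/
theorem exists_subgroup_of_arcTransitive_circulant {p : ℕ} [Fact p.Prime]
    {R : SimpleGraph (ZMod p)} (hadj : ∀ x y, R.Adj x y ↔ R.Adj 0 (y - x)) (hR : ArcTransitive R)
    (hbot : R ≠ ⊥) (htop : R ≠ ⊤) :
    ∃ (M : Subgroup (ZMod p)ˣ) (s : (ZMod p)ˣ), ∀ z : (ZMod p)ˣ, R.Adj 0 z ↔ z / s ∈ M := by
  obtain ⟨x, y, hxy⟩ := ne_bot_iff_exists_adj.1 hbot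
  have hs := (hadj x y).1 hxy
  have hmul (t u z : (ZMod p)ˣ) (ht : R.Adj 0 t) (hu : R.Adj 0 u) (hz : R.Adj 0 z) :
      R.Adj 0 (u / t * z : (ZMod p)ˣ) := by
    obtain ⟨φ, h0, h1⟩ := hR ht hu
    obtain ⟨a, b, hab⟩ := affine_of_circulant_iso hadj hbot htop φ
    rw [hab] at h0 h1
    obtain rfl : b = 0 := by simpa using h0
    rw [add_zero] at h1
    have h2 := φ.map_adj_iff.2 hz
    rw [hab, hab] at h2
    have ha : a = (u / t : (ZMod p)ˣ) := by
      rw [Units.val_div_eq_div_val, ← h1, mul_div_cancel_right₀ _ t.ne_zero]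
    simpa [ha] using h2
  set s := Units.mk0 _ hs.ne'
  have hs' : R.Adj 0 s := hs
  refine ⟨{ carrier := {z | R.Adj 0 (s * z : (ZMod p)ˣ)}
            mul_mem' := fun {z w} hz hw => ?_
            one_mem' := by simpa using hs'
            inv_mem' := fun {z} hz => ?_ }, s, fun z => ?_⟩
  · have := hmul _ _ _ hs' hz hw
    rwa [show s * z / s * (s * w) = s * (z * w) by
      rw [mul_div_cancel_left]; exact mul_left_comm ..] at this
  · have := hmul _ _ _ hz hs' hs'
    rwa [show s / (s * z) * s = s * z⁻¹ by rw [div_mul_cancel_left]; exact mul_comm ..] at this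
  · rw [← Subgroup.mem_carrier]
    simp only [Set.mem_ofPred_eq, mul_div_cancel]

theorem ncard_neighborSet_of_circulant {p : ℕ} [Fact p.Prime] {R : SimpleGraph (ZMod p)}
    {M : Subgroup (ZMod p)ˣ} {s : (ZMod p)ˣ} (hM : ∀ z : (ZMod p)ˣ, R.Adj 0 z ↔ z / s ∈ M) :
    (R.neighborSet 0).ncard = Nat.card M := by
  have : R.neighborSet 0 = (fun m : (ZMod p)ˣ => ((m * s : (ZMod p)ˣ) : ZMod p)) '' M := by
    ext z
    simp only [mem_neighborSet, Set.mem_image, SetLike.mem_coe]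
    constructor
    · intro h
      exact ⟨Units.mk0 z h.ne' / s, (hM _).1 h, by simp⟩
    · rintro ⟨m, hm, rfl⟩
      rwa [hM, mul_div_cancel_right]
  rw [this, Set.ncard_image_of_injective _ fun a b h => mul_right_cancel (Units.ext h)]
  exact (Nat.card_coe_set_eq _).symm

/-- A circulant graph whose connection set is a coset of a subgroup of index 2 is
self-complementary. -/
theorem selfComplementary_of_circulant {p : ℕ} [Fact p.Prime] {R : SimpleGraph (ZMod p)}
    (hadj : ∀ x y, R.Adj x y ↔ R.Adj 0 (y - x))
    {M : Subgroup (ZMod p)ˣ} {s : (ZMod p)ˣ} (hM : ∀ z : (ZMod p)ˣ, R.Adj 0 z ↔ z / s ∈ M)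
    (hcard : 2 * Nat.card M = p - 1) : Nonempty (R ≃g Rᶜ) := by
  have hidx : M.index = 2 := by
    have h := M.index_mul_card
    rw [Nat.card_eq_fintype_card (α := (ZMod p)ˣ), ZMod.card_units, ← hcard] at h
    exact Nat.eq_of_mul_eq_mul_right Nat.card_pos h
  obtain ⟨c, hc⟩ := Subgroup.index_eq_two_iff.1 hidx
  have hcM (z : (ZMod p)ˣ) : R.Adj 0 (c * z : (ZMod p)ˣ) ↔ ¬ R.Adj 0 z := by
    rw [hM, hM, show c * z / s = z / s * c by rw [mul_comm c, mul_div_right_comm]]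
    have := hc (z / s)
    simp only [xor_def] at this
    tauto
  refine ⟨{ toEquiv := Units.mulLeft c, map_rel_iff' := fun {x y} => ?_ }⟩
  by_cases hxy : x = y
  · simp [hxy]
  · have hz := hcM (Units.mk0 (y - x) (sub_ne_zero.2 (Ne.symm hxy)))
    simp only [Units.val_mul, Units.val_mk0, mul_sub] at hz
    rw [← hadj x y, ← hadj] at hz
    simp [compl_adj, hz, hxy]

/-- A vertex-transitive graph of prime order is circulant. -/
theorem exists_circulant_labelling {X : Type*} [Finite X] {p : ℕ} [Fact p.Prime]
    (hX : Nat.card X = p) {R : SimpleGraph X} (hR : ∀ a b, ∃ φ : R ≃g R, φ a = b) :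
    ∃ e : ZMod p ≃ X, ∀ x y, R.Adj (e x) (e y) ↔ R.Adj (e 0) (e (y - x)) := by
  classical
  have hp : p.Prime := Fact.out
  have := Fintype.ofFinite X
  have : Finite (R ≃g R) := Finite.of_injective _ (DFunLike.coe_injective (F := R ≃g R))
  have := Fintype.ofFinite (R ≃g R)
  have hne : Nonempty X := (Nat.card_pos_iff.1 (hX ▸ hp.pos)).1
  obtain ⟨x₀⟩ := hne
  have hdvd : p ∣ Fintype.card (R ≃g R) := by
    have h := MulAction.card_orbit_mul_card_stabilizer_eq_card_group (R ≃g R) x₀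
    have ho : MulAction.orbit (R ≃g R) x₀ = Set.univ := Set.eq_univ_of_forall fun y => hR x₀ y
    rw [← Nat.card_eq_fintype_card, ho, Nat.card_univ, hX] at h
    exact ⟨_, h.symm⟩
  obtain ⟨h, hord⟩ := exists_prime_orderOf_dvd_card p hdvd
  have hpow (k : ℕ) (x : X) : (h ^ k) x = h^[k] x := by
    induction k generalizing x with
    | zero => rfl
    | succ k ih => rw [pow_succ, Function.iterate_succ_apply, ← ih]; rfl
  obtain ⟨x, hx⟩ : ∃ x, h x ≠ x := by
    by_contra! hh
    have : h = 1 := RelIso.ext hh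
    rw [this, orderOf_one] at hord
    exact hp.one_lt.ne hord
  have hper (y : X) : h^[p] y = y := by
    rw [← hpow, ← hord, pow_orderOf_eq_one]; rfl
  have hmin : Function.minimalPeriod h x = p := by
    refine ((Nat.dvd_prime hp).1 (Function.IsPeriodicPt.minimalPeriod_dvd (hper x))).resolve_left
      fun h1 => hx ?_
    exact Function.minimalPeriod_eq_one_iff_isFixedPt.1 h1
  have hinj : Function.Injective fun i : ZMod p => h^[i.val] x := fun i j hij => by
    refine ZMod.val_injective p (Function.iterate_injOn_Iio_minimalPeriod ?_ ?_ hij) <;>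
    · rw [hmin]
      exact ZMod.val_lt _
  have hbij : Function.Bijective fun i : ZMod p => h^[i.val] x := by
    rw [Fintype.bijective_iff_injective_and_card]
    exact ⟨hinj, by rw [ZMod.card, ← Nat.card_eq_fintype_card, hX]⟩
  have hadd (i : ZMod p) (k : ℕ) : h^[(i + k).val] x = h^[k] (h^[i.val] x) := by
    rw [← Function.iterate_add_apply, ZMod.val_add, ZMod.val_natCast, Nat.add_mod_mod, add_comm k]
    have := Function.iterate_mod_minimalPeriod_eq (f := h) (x := x) (n := i.val + k)
    rwa [hmin] at this
  refine ⟨Equiv.ofBijective _ hbij, fun i j => ?_⟩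
  simp only [Equiv.ofBijective_apply]
  have h1 := hadd 0 i.val
  have h2 := hadd (j - i) i.val
  rw [ZMod.natCast_zmod_val] at h1 h2
  rw [zero_add] at h1
  rw [sub_add_cancel] at h2
  rw [h1, h2, ← hpow i.val, ← hpow i.val]
  exact Iso.map_adj_iff (h ^ i.val)

/-- The valency `n` of an arc-transitive graph of prime order `p`, neither complete nor empty,
divides `p - 1`, and such a graph with `n = (p - 1) / 2` is self-complementary. -/
theorem arcTransitive_of_prime_card {X : Type*} [Finite X] {p : ℕ} [Fact p.Prime]
    (hX : Nat.card X = p) {R : SimpleGraph X} (hvt : ∀ a b, ∃ φ : R ≃g R, φ a = b)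
    (hR : ArcTransitive R) (hbot : R ≠ ⊥) (htop : R ≠ ⊤) :
    ∃ n, 0 < n ∧ n < p - 1 ∧ n ∣ p - 1 ∧ (∀ x, (R.neighborSet x).ncard = n) ∧
      (2 * n = p - 1 → Nonempty (R ≃g Rᶜ)) ∧
      ∃ a b c, R.Adj a b ∧ R.Adj b c ∧ a ≠ c ∧ ¬ R.Adj a c := by
  obtain ⟨e, he⟩ := exists_circulant_labelling hX hvt
  let f : R.comap e ≃g R := Iso.comap e R
  have hf (x : ZMod p) : f x = e x := rfl
  have hadj (x y : ZMod p) : (R.comap e).Adj x y ↔ (R.comap e).Adj 0 (y - x) := he x y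
  have hR' : ArcTransitive (R.comap e) := by
    intro v u v' u' h h'
    obtain ⟨φ, h1, h2⟩ := hR h h'
    exact ⟨(f.trans φ).trans f.symm, by simp [hf, h1, f.symm_apply_eq],
      by simp [hf, h2, f.symm_apply_eq]⟩
  have hbot' : R.comap e ≠ ⊥ := by
    obtain ⟨x, y, h⟩ := ne_bot_iff_exists_adj.1 hbot
    exact ne_bot_iff_exists_adj.2 ⟨e.symm x, e.symm y, by simpa using h⟩
  have htop' : R.comap e ≠ ⊤ := by
    obtain ⟨x, y, hne, h⟩ := ne_top_iff_exists_not_adj.1 htop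
    exact ne_top_iff_exists_not_adj.2 ⟨e.symm x, e.symm y, by simpa using hne, by simpa using h⟩
  obtain ⟨M, s, hM⟩ := exists_subgroup_of_arcTransitive_circulant hadj hR' hbot' htop'
  have hdeg (x : X) : (R.neighborSet x).ncard = Nat.card M := by
    obtain ⟨φ, rfl⟩ := hvt (f 0) x
    rw [φ.ncard_neighborSet, f.ncard_neighborSet, ncard_neighborSet_of_circulant hM]
  refine ⟨Nat.card M, Nat.card_pos, ?_, ?_, hdeg, fun h => ?_, ?_⟩
  · obtain ⟨x, y, hne, h⟩ := ne_top_iff_exists_not_adj.1 htop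
    have h1 : R.neighborSet x ⊆ ({x, y} : Set X)ᶜ := fun z hz => by
      rintro (rfl | rfl)
      · exact hz.ne rfl
      · exact h hz
    have h2 := Set.ncard_le_ncard h1
    have h3 := Set.ncard_add_ncard_compl ({x, y} : Set X)
    rw [Set.ncard_pair hne, hX] at h3
    rw [hdeg] at h2
    omega
  · have := Subgroup.card_subgroup_dvd_card M
    rwa [Nat.card_eq_fintype_card (α := (ZMod p)ˣ), ZMod.card_units] at this
  · obtain ⟨σ⟩ := selfComplementary_of_circulant hadj hM h
    have hσ (x y : ZMod p) : (R.comap e)ᶜ.Adj (σ x) (σ y) ↔ (R.comap e).Adj x y := σ.map_adj_iff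
    refine ⟨{ toEquiv := (e.symm.trans σ.toEquiv).trans e, map_rel_iff' := fun {x y} => ?_ }⟩
    have := hσ (e.symm x) (e.symm y)
    simpa [compl_adj] using this
  · obtain ⟨a, b, c, h1, h2, h3, h4⟩ := exists_two_path_of_circulant hadj hbot' htop'
    exact ⟨e a, e b, e c, h1, h2, e.injective.ne h3, h4⟩

/-- The non-adjacency graph on the neighbourhood of a vertex. -/
def localCompl {V : Type*} (Γ : SimpleGraph V) (u : V) : SimpleGraph (Γ.neighborSet u) :=
  (Γ.induce (Γ.neighborSet u))ᶜ

theorem localCompl_adj {V : Type*} {Γ : SimpleGraph V} {u : V} {a b : Γ.neighborSet u} :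
    (localCompl Γ u).Adj a b ↔ Is2Geodesic Γ a u b := by
  have ha : Γ.Adj a u := a.2.symm
  have hb : Γ.Adj u b := b.2
  simp [localCompl, compl_adj, Is2Geodesic, ha, hb, Subtype.ext_iff]

theorem localCompl_compl_adj {V : Type*} {Γ : SimpleGraph V} {u : V} {a b : Γ.neighborSet u} :
    (localCompl Γ u)ᶜ.Adj a b ↔ Γ.Adj a b := by
  simp [localCompl]

/-- The local action of an automorphism that fixes a vertex. -/
theorem exists_localCompl_iso {V : Type*} {Γ : SimpleGraph V} {u : V} {φ : Γ ≃g Γ} (hφ : φ u = u) :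
    ∃ ψ : localCompl Γ u ≃g localCompl Γ u, ∀ a, (ψ a : V) = φ a := by
  have h (x : V) : x ∈ Γ.neighborSet u ↔ φ x ∈ Γ.neighborSet u := by
    rw [mem_neighborSet, mem_neighborSet, ← φ.map_adj_iff, hφ]
  refine ⟨{ toEquiv := φ.toEquiv.subtypeEquiv h, map_rel_iff' := fun {a b} => ?_ }, fun a => rfl⟩
  have hab : Γ.Adj (φ a) (φ b) ↔ Γ.Adj a b := φ.map_adj_iff
  simp [localCompl, compl_adj, hab, Subtype.ext_iff]

theorem ArcTransitive.localCompl_vertexTransitive {V : Type*} {Γ : SimpleGraph V}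
    (h : ArcTransitive Γ) (u : V) (a b : Γ.neighborSet u) :
    ∃ ψ : localCompl Γ u ≃g localCompl Γ u, ψ a = b := by
  obtain ⟨φ, hu, hab⟩ := h a.2 b.2
  obtain ⟨ψ, hψ⟩ := exists_localCompl_iso hu
  exact ⟨ψ, Subtype.ext ((hψ a).trans hab)⟩

theorem TwoGeodesicTransitive.localCompl_arcTransitive {V : Type*} {Γ : SimpleGraph V}
    (h : TwoGeodesicTransitive Γ) (u : V) : ArcTransitive (localCompl Γ u) := by
  intro a b a' b' hab hab'
  obtain ⟨φ, h1, hu, h2⟩ := h.2 (localCompl_adj.1 hab) (localCompl_adj.1 hab')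
  obtain ⟨ψ, hψ⟩ := exists_localCompl_iso hu
  exact ⟨ψ, Subtype.ext ((hψ a).trans h1), Subtype.ext ((hψ b).trans h2)⟩

theorem TwoGeodesicTransitive.localCompl_ne_top {V : Type*} {Γ : SimpleGraph V}
    (h : TwoGeodesicTransitive Γ) (h' : ¬ TwoArcTransitive Γ) {v u : V} (hvu : Γ.Adj v u) :
    localCompl Γ u ≠ ⊤ := by
  intro htop
  have key (a x b : V) (hab : Is2Arc Γ a x b) : Is2Geodesic Γ a x b := by
    obtain ⟨h1, h2, h3⟩ := hab
    refine ⟨h1, h2, h3, fun h4 => ?_⟩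
    obtain ⟨φ, rfl, rfl⟩ := h.1 h1 hvu
    have h5 : (localCompl Γ (φ x)).Adj ⟨φ a, hvu.symm⟩ ⟨φ b, φ.map_adj_iff.2 h2⟩ := by
      rw [htop, top_adj]
      simpa [Subtype.ext_iff] using h3
    exact (localCompl_adj.1 h5).2.2.2 (φ.map_adj_iff.2 h4)
  exact h' ⟨h.1, fun _ _ _ _ _ _ hg hg' => h.2 (key _ _ _ hg) (key _ _ _ hg')⟩

theorem SimpleGraph.Iso.is2Geodesic_iff {V : Type*} {Γ : SimpleGraph V} (φ : Γ ≃g Γ) {v u w : V} :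
    Is2Geodesic Γ (φ v) (φ u) (φ w) ↔ Is2Geodesic Γ v u w := by
  simp [Is2Geodesic, φ.map_adj_iff]

theorem ArcTransitive.ncard_is2Geodesic_eq {V : Type*} {Γ : SimpleGraph V} (h : ArcTransitive Γ)
    {v u v' u' : V} (hvu : Γ.Adj v u) (hvu' : Γ.Adj v' u') :
    {w | Is2Geodesic Γ v' u' w}.ncard = {w | Is2Geodesic Γ v u w}.ncard := by
  obtain ⟨φ, rfl, rfl⟩ := h hvu hvu'
  have : {w | Is2Geodesic Γ (φ v) (φ u) w} = φ '' {w | Is2Geodesic Γ v u w} := by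
    ext x
    obtain ⟨x, rfl⟩ := φ.surjective x
    simp [φ.is2Geodesic_iff]
  rw [this, Set.ncard_image_of_injective _ φ.injective]

theorem ncard_neighborSet_localCompl {V : Type*} {Γ : SimpleGraph V} {u : V}
    (a : Γ.neighborSet u) :
    ((localCompl Γ u).neighborSet a).ncard = {w | Is2Geodesic Γ a u w}.ncard := by
  have : {w | Is2Geodesic Γ a u w} = (↑) '' (localCompl Γ u).neighborSet a := by
    ext x
    simp only [Set.mem_ofPred_eq, Set.mem_image, mem_neighborSet, localCompl_adj]
    exact ⟨fun h => ⟨⟨x, h.2.1⟩, h, rfl⟩, by rintro ⟨y, hy, rfl⟩; exact hy⟩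
  rw [this, Set.ncard_image_of_injective _ Subtype.val_injective]

/-- Counting the 2-geodesics that start at a vertex in two ways. -/
theorem dvd_mul_of_ncard_is2Geodesic {V : Type*} [Finite V] {Γ : SimpleGraph V} {p n c : ℕ} {v : V}
    (hp : (Γ.neighborSet v).ncard = p)
    (hn : ∀ u, Γ.Adj v u → {w | Is2Geodesic Γ v u w}.ncard = n)
    (hc : ∀ u w, Is2Geodesic Γ v u w → (Γ.commonNeighbors v w).ncard = c) : c ∣ p * n := by
  classical
  have := Fintype.ofFinite V
  let W : Finset V := {w | ∃ u, Is2Geodesic Γ v u w}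
  have h := Finset.card_mul_eq_card_mul (s := Γ.neighborFinset v) (t := W) (m := n) (n := c) Γ.Adj
    (fun u hu => ?_) fun w hw => ?_
  · rw [← hp, Set.ncard_eq_toFinset_card']
    exact ⟨W.card, (h.trans (mul_comm _ _))⟩
  · rw [mem_neighborFinset] at hu
    rw [← hn u hu, Set.ncard_eq_toFinset_card']
    congr 1
    ext w
    simp only [Finset.mem_bipartiteAbove, W, Finset.mem_filter_univ, Set.mem_toFinset,
      Set.mem_ofPred_eq]
    exact ⟨fun ⟨⟨_, h1⟩, h2⟩ => ⟨hu, h2, h1.2.2⟩, fun h => ⟨⟨u, h⟩, h.2.1⟩⟩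
  · obtain ⟨u, hu⟩ := (Finset.mem_filter_univ _).1 hw
    rw [← hc u w hu, Set.ncard_eq_toFinset_card']
    congr 1
    ext x
    simp [Finset.mem_bipartiteBelow, mem_commonNeighbors, Γ.adj_comm x w]

/-- A lower bound for the number of common neighbours of two non-adjacent vertices of degree `n`
in the complement. -/
theorem card_le_ncard_commonNeighbors_compl {X : Type*} [Finite X] {R : SimpleGraph X} {n : ℕ}
    (hn : ∀ x, (R.neighborSet x).ncard = n) {a b : X} (hab : R.Adj a b) :
    Nat.card X ≤ (Rᶜ.commonNeighbors a b).ncard + 2 * n := by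
  have h : (Rᶜ.commonNeighbors a b)ᶜ ⊆ R.neighborSet a ∪ R.neighborSet b := by
    intro x hx
    by_contra hx'
    simp only [Set.mem_union, mem_neighborSet, not_or] at hx'
    refine hx ⟨?_, ?_⟩
    · refine (compl_adj ..).2 ⟨?_, hx'.1⟩
      rintro rfl
      exact hx'.2 hab.symm
    · refine (compl_adj ..).2 ⟨?_, hx'.2⟩
      rintro rfl
      exact hx'.1 hab
  have h1 := (Set.ncard_le_ncard h).trans (Set.ncard_union_le _ _)
  have h2 := Set.ncard_add_ncard_compl (Rᶜ.commonNeighbors a b)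
  rw [hn, hn] at h1
  omega

theorem ncard_commonNeighbors_localCompl_lt {V : Type*} [Finite V] {Γ : SimpleGraph V} {u : V}
    (a b : Γ.neighborSet u) :
    ((localCompl Γ u)ᶜ.commonNeighbors a b).ncard < (Γ.commonNeighbors a b).ncard := by
  rw [← Set.ncard_image_of_injective _ Subtype.val_injective]
  refine Set.ncard_lt_ncard ((Set.ssubset_iff_of_subset ?_).2 ⟨u, ⟨a.2.symm, b.2.symm⟩, ?_⟩)
  · rintro _ ⟨x, ⟨h1, h2⟩, rfl⟩
    exact ⟨localCompl_compl_adj.1 h1, localCompl_compl_adj.1 h2⟩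
  · rintro ⟨x, -, hx⟩
    exact x.2.ne hx.symm

theorem stmt6 {V : Type*} [Fintype V] (Γ : SimpleGraph V) (p : ℕ)
    (hp : p.Prime)
    (hreg : ∀ v : V, Nat.card (Γ.neighborSet v) = p)
    (hconn : Γ.Connected)
    (hnc : Γ ≠ ⊤)
    (h2gt : TwoGeodesicTransitive Γ)
    (h2at : ¬ TwoArcTransitive Γ) :
    ∀ v u w : V, Is2Geodesic Γ v u w →
      Nat.card {x : V | Γ.Adj v x ∧ Γ.Adj w x} = (p - 1) / 2 := by
  intro v u w hg
  have : Fact p.Prime := ⟨hp⟩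
  have hreg' (x : V) : (Γ.neighborSet x).ncard = p := by
    rw [← Nat.card_coe_set_eq, hreg]
  change Nat.card (Γ.commonNeighbors v w) = _
  rw [Nat.card_coe_set_eq]
  have hab : (localCompl Γ u).Adj ⟨v, hg.1.symm⟩ ⟨w, hg.2.1⟩ := localCompl_adj.2 hg
  obtain ⟨n, hn0, hnp, hdvd, hdeg, hself, a, b, c, h1, h2, hac, h3⟩ :=
    arcTransitive_of_prime_card (hreg u) (h2gt.1.localCompl_vertexTransitive u)
      (h2gt.localCompl_arcTransitive u) (ne_bot_iff_exists_adj.2 ⟨_, _, hab⟩)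
      (h2gt.localCompl_ne_top h2at hg.1)
  have hconst (x y z : V) (h : Is2Geodesic Γ x y z) :
      (Γ.commonNeighbors x z).ncard = (Γ.commonNeighbors v w).ncard := by
    obtain ⟨φ, rfl, -, rfl⟩ := h2gt.2 hg h
    exact φ.ncard_commonNeighbors v w
  have hcount : (Γ.commonNeighbors v w).ncard ∣ p * n := by
    refine dvd_mul_of_ncard_is2Geodesic (hreg' v) (fun y hy => ?_) fun y z h => hconst v y z h
    rw [h2gt.1.ncard_is2Geodesic_eq hg.1 hy, ← hdeg ⟨v, hg.1.symm⟩, ncard_neighborSet_localCompl]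
  have hle : (Γ.commonNeighbors v w).ncard ≤ p := by
    rw [← hreg' v]
    exact Set.ncard_le_ncard Set.inter_subset_left
  have hnep : (Γ.commonNeighbors v w).ncard ≠ p := by
    intro h
    have hab' := localCompl_adj.1 h1
    have hsub : Γ.commonNeighbors (a : V) b = Γ.neighborSet a :=
      Set.eq_of_subset_of_ncard_le Set.inter_subset_left (by rw [hconst _ _ _ hab', h, hreg'])
    have hadj : Γ.Adj a c := by
      by_contra hn
      exact h3 (localCompl_adj.2 ⟨a.2.symm, c.2, Subtype.coe_injective.ne hac, hn⟩)
    have hc : (c : V) ∈ Γ.commonNeighbors (a : V) b := hsub ▸ hadj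
    exact (localCompl_adj.1 h2).2.2.2 hc.2
  have hlow := card_le_ncard_commonNeighbors_compl hdeg hab
  have hlt : _ < (Γ.commonNeighbors v w).ncard :=
    ncard_commonNeighbors_localCompl_lt (⟨v, hg.1.symm⟩ : Γ.neighborSet u) ⟨w, hg.2.1⟩
  rw [hreg] at hlow
  have hcn : (Γ.commonNeighbors v w).ncard ∣ n := by
    refine Nat.Coprime.dvd_of_dvd_mul_left ?_ hcount
    exact (Nat.coprime_of_lt_prime (by omega) (hle.lt_of_ne hnep) hp).symm
  obtain ⟨k, hk⟩ := hcn
  obtain ⟨m, hm⟩ := hdvd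
  have hk0 : k ≠ 0 := by rintro rfl; omega
  have hcle : (Γ.commonNeighbors v w).ncard ≤ n := hk ▸ Nat.le_mul_of_pos_right _ (by omega)
  have hm2 : m = 2 := by
    have : m ≠ 0 := by rintro rfl; omega
    have : m ≠ 1 := by rintro rfl; omega
    by_contra h
    have : n * 3 ≤ n * m := Nat.mul_le_mul_left n (by omega)
    omega
  subst hm2
  obtain ⟨σ⟩ := hself (by omega)
  have hhalf := two_mul_ncard_commonNeighbors_compl hn0 hdeg (h2gt.localCompl_arcTransitive u) σ hab
  have hk1 : k = 1 := by
    by_contra h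
    have := Nat.mul_le_mul_left (Γ.commonNeighbors v w).ncard (show 2 ≤ k by omega)
    omega
  subst hk1
  omega
end

section
/- Let Γ be a finite connected non-complete graph of prime valency p that is 2-geodesic transitive but not 2-arc transitive. Then for every 2-geodesic (v,u,w) of Γ, the number of vertices that are at distance 2 from v and adjacent to both u and w equals (p-1)/4. -/
open SimpleGraph

/-- The power sums of exponents `1, …, |S|` of a non-empty set `S` of non-zero elements do not all
vanish. -/
theorem exists_sum_pow_ne_zero {F : Type*} [Field F] (S : Finset F)
    (h0 : (0 : F) ∉ S) (hS : S.Nonempty) :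
    ∃ j, 1 ≤ j ∧ j ≤ S.card ∧ ∑ d ∈ S, d ^ j ≠ 0 := by
  classical
  by_contra! hcon
  obtain ⟨d₀, hd₀⟩ := hS
  set g : Polynomial F :=
    Polynomial.X * ∏ d ∈ S.erase d₀, (Polynomial.X - Polynomial.C d) with hg
  have hdeg : g.natDegree < S.card + 1 := by
    refine Nat.lt_succ_of_le (Polynomial.natDegree_mul_le.trans ?_)
    rw [Polynomial.natDegree_X, Polynomial.natDegree_finsetProd_X_sub_C_eq_card,
      Finset.card_erase_of_mem hd₀]
    have := Finset.card_pos.mpr ⟨d₀, hd₀⟩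
    omega
  have h1 : ∑ d ∈ S, g.eval d = 0 := by
    simp_rw [Polynomial.eval_eq_sum_range' hdeg]
    rw [Finset.sum_comm]
    refine Finset.sum_eq_zero fun j hj => ?_
    rw [← Finset.mul_sum]
    rcases Nat.eq_zero_or_pos j with rfl | hj0
    · simp [hg]
    · rw [hcon j hj0 (Nat.lt_succ_iff.mp (Finset.mem_range.mp hj)), mul_zero]
  rw [Finset.sum_eq_single_of_mem d₀ hd₀] at h1
  · rw [hg, Polynomial.eval_mul, Polynomial.eval_X, Polynomial.eval_prod, mul_eq_zero,
      Finset.prod_eq_zero_iff] at h1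
    rcases h1 with h1 | ⟨d, hd, h1⟩
    · exact h0 (h1 ▸ hd₀)
    · rw [Polynomial.eval_sub, Polynomial.eval_X, Polynomial.eval_C, sub_eq_zero] at h1
      exact Finset.ne_of_mem_erase hd h1.symm
  · intro d hd hne
    rw [hg, Polynomial.eval_mul, Polynomial.eval_prod,
      Finset.prod_eq_zero (Finset.mem_erase.mpr ⟨hne, hd⟩) (by simp), mul_zero]

/-- If the power sums of `S` of positive exponent less than `r` vanish, then the operator
`f ↦ ∑ d ∈ S, (f (X + d) - f)` lowers degrees by at least `r`, with this leading coefficient. -/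
theorem coeff_sum_taylor_sub {F : Type*} [Field F] (S : Finset F) {r : ℕ} (hr : 1 ≤ r)
    (hz : ∀ j, 1 ≤ j → j < r → ∑ d ∈ S, d ^ j = 0) (f : Polynomial F) (hf : r ≤ f.natDegree) :
    (∑ d ∈ S, (Polynomial.taylor d f - f)).coeff (f.natDegree - r) =
      (f.natDegree.choose r : F) * f.leadingCoeff * ∑ d ∈ S, d ^ r := by
  set n := f.natDegree with hn
  set l := n - r with hl
  have hcoeff : ∀ d, (Polynomial.taylor d f).coeff l =
      ∑ i ∈ Finset.range (n + 1), ((i.choose l : F) * f.coeff i) * d ^ (i - l) := by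
    intro d
    rw [Polynomial.taylor_coeff, Polynomial.hasseDeriv_apply, Polynomial.sum_over_range]
    · rw [Polynomial.eval_finsetSum]
      simp [← hn]
    · simp
  have hsum : ∑ d ∈ S, (Polynomial.taylor d f).coeff l =
      ∑ i ∈ Finset.range (n + 1), ((i.choose l : F) * f.coeff i) * ∑ d ∈ S, d ^ (i - l) := by
    simp_rw [hcoeff]
    rw [Finset.sum_comm]
    simp_rw [Finset.mul_sum]
  rw [Polynomial.finsetSum_coeff]
  simp_rw [Polynomial.coeff_sub]
  rw [Finset.sum_sub_distrib, hsum, Finset.sum_range_succ, Finset.sum_eq_single l]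
  · have h1 : n - l = r := by omega
    have h2 : n.choose l = n.choose r := Nat.choose_symm hf
    simp only [h1, h2, Nat.choose_self, Nat.sub_self, pow_zero, Finset.sum_const, nsmul_eq_mul,
      Polynomial.leadingCoeff, ← hn]
    push_cast
    ring
  · intro i hi hil
    rcases lt_or_gt_of_ne hil with h | h
    · simp [Nat.choose_eq_zero_of_lt h]
    · have := Finset.mem_range.mp hi
      rw [hz _ (by omega) (by omega), mul_zero]
  · intro h
    exact absurd (Finset.mem_range.mpr (by omega)) h

theorem sum_add_pow_of_sum_pow_eq_zero {F : Type*} [Field F] (S : Finset F) {j : ℕ} (hj : 1 ≤ j)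
    (hz : ∀ i, 1 ≤ i → i < j → ∑ d ∈ S, d ^ i = 0) (y : F) :
    ∑ d ∈ S, (d + y) ^ j = S.card * y ^ j + ∑ d ∈ S, d ^ j := by
  obtain ⟨j, rfl⟩ : ∃ i, j = i + 1 := ⟨j - 1, by omega⟩
  simp_rw [add_pow]
  rw [Finset.sum_comm, Finset.sum_range_succ', Finset.sum_range_succ, Finset.sum_eq_zero]
  · simp [add_comm]
  · intro i hi
    have := Finset.mem_range.mp hi
    simp_rw [mul_assoc]
    rw [← Finset.sum_mul, hz _ (by omega) (by omega), zero_mul]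

theorem exists_affine_of_preserves_differences_of_two_mul_card_le {p : ℕ} [Fact p.Prime]
    (S : Finset (ZMod p)) (h0 : (0 : ZMod p) ∉ S) (hS : S.Nonempty) (hcard : 2 * S.card ≤ p - 1)
    (π : Equiv.Perm (ZMod p)) (hπ : ∀ x y, y - x ∈ S ↔ π y - π x ∈ S) :
    ∃ a b : ZMod p, ∀ x, π x = a * x + b := by
  classical
  have hp : p.Prime := Fact.out
  have hex := exists_sum_pow_ne_zero S h0 hS
  set r := Nat.find hex with hr
  obtain ⟨hr1, hrS, hrne⟩ := Nat.find_spec hex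
  rw [← hr] at hr1 hrS hrne
  have hz : ∀ j, 1 ≤ j → j < r → ∑ d ∈ S, d ^ j = 0 := by
    intro j hj hjr
    by_contra hne
    exact Nat.find_min hex hjr ⟨hj, by omega, hne⟩
  have hinj : Set.InjOn (id : ZMod p → ZMod p) ((Finset.univ : Finset (ZMod p)) : Set (ZMod p)) :=
    Function.injective_id.injOn
  set P := Lagrange.interpolate (Finset.univ : Finset (ZMod p)) id π with hP
  have hPe : ∀ x, P.eval x = π x := fun x =>
    Lagrange.eval_interpolate_at_node (v := id) (π : ZMod p → ZMod p) hinj (Finset.mem_univ x)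
  have hPd : P.natDegree < p := by
    have h := Lagrange.degree_interpolate_lt (π : ZMod p → ZMod p) hinj
    rw [Finset.card_univ, ZMod.card, ← hP] at h
    rcases eq_or_ne P 0 with h' | h'
    · rw [h', Polynomial.natDegree_zero]; exact hp.pos
    · exact (Polynomial.natDegree_lt_iff_degree_lt h').mpr h
  set n := P.natDegree with hn
  have hn1 : 1 ≤ n := by
    by_contra h
    have hC := Polynomial.eq_C_of_natDegree_eq_zero (show P.natDegree = 0 by omega)
    have : π 0 = π 1 := by
      rw [← hPe, ← hPe, hC]; simp
    exact zero_ne_one (π.injective this)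
  have key : ∀ j, 1 ≤ j → j ≤ r → r ≤ j * n → j * n < p → j = r ∧ j * n = r := by
    intro j hj hjr hrn hnp
    have hdeg : (P ^ j).natDegree = j * n := by rw [Polynomial.natDegree_pow]
    set s := ∑ d ∈ S, d ^ j with hs
    have hzero : ∑ d ∈ S, (Polynomial.taylor d (P ^ j) - P ^ j) - Polynomial.C s = 0 := by
      refine Polynomial.eq_zero_of_natDegree_lt_card_of_eval_eq_zero' _ Finset.univ ?_ ?_
      · intro x _
        have h1 : ∑ d ∈ S, π (x + d) ^ j = ∑ d ∈ S, (d + π x) ^ j := by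
          refine Finset.sum_bij' (fun d _ => π (x + d) - π x)
            (fun d _ => π.symm (d + π x) - x) ?_ ?_ ?_ ?_ ?_
          · intro d hd
            rw [← hπ]; simpa using hd
          · intro d hd
            rw [hπ]; simpa using hd
          · intro d _; simp
          · intro d _; simp
          · intro d _; simp
        have h2 := sum_add_pow_of_sum_pow_eq_zero S hj
          (fun i hi hij => hz i hi (by omega)) (π x)
        rw [Polynomial.eval_sub, Polynomial.eval_finsetSum, Polynomial.eval_C]
        simp only [Polynomial.eval_sub, Polynomial.taylor_eval, Polynomial.eval_pow, hPe]
        rw [Finset.sum_sub_distrib, h1, h2, Finset.sum_const, nsmul_eq_mul]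
        ring
      · rw [Finset.card_univ, ZMod.card]
        refine lt_of_le_of_lt (b := j * n) ?_ hnp
        refine (Polynomial.natDegree_sub_le _ _).trans (max_le ?_ (by simp))
        refine Polynomial.natDegree_sum_le_of_forall_le _ _ fun d _ => ?_
        refine (Polynomial.natDegree_sub_le _ _).trans (max_le ?_ hdeg.le)
        rw [Polynomial.natDegree_taylor, hdeg]
    have hco := coeff_sum_taylor_sub S hr1 hz (P ^ j) (by omega)
    rw [sub_eq_zero.mp hzero, hdeg, Polynomial.coeff_C] at hco
    have hne : ((j * n).choose r : ZMod p) * (P ^ j).leadingCoeff * ∑ d ∈ S, d ^ r ≠ 0 := by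
      refine mul_ne_zero (mul_ne_zero ?_ ?_) hrne
      · rw [Ne, ZMod.natCast_eq_zero_iff]
        intro hdvd
        have h3 := Nat.choose_mul_factorial_mul_factorial hrn
        have h4 : p ∣ (j * n).factorial :=
          h3 ▸ dvd_mul_of_dvd_left (dvd_mul_of_dvd_left hdvd _) _
        exact absurd (hp.dvd_factorial.mp h4) (by omega)
      · rw [Polynomial.leadingCoeff_ne_zero]
        refine pow_ne_zero _ ?_
        rintro h
        rw [hn, h] at hn1
        simp at hn1
    rw [← hco] at hne
    split_ifs at hne with h
    · refine ⟨?_, by omega⟩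
      by_contra hjne
      exact hne (hz j hj (by omega))
    · exact absurd rfl hne
  have hn_eq : n = 1 := by
    rcases lt_or_ge r n with h | h
    · have := key 1 le_rfl hr1 (by omega) (by omega)
      omega
    · have hdm := Nat.div_add_mod (r + n - 1) n
      have hml := Nat.mod_lt (r + n - 1) (show n > 0 by omega)
      set j := (r + n - 1) / n
      have hj1 : 1 ≤ j := (Nat.one_le_div_iff (by omega)).mpr (by omega)
      rw [mul_comm] at hdm
      have hjr : j ≤ r := by
        by_contra hjr
        have : (r + 1) * n ≤ j * n := Nat.mul_le_mul_right n (by omega)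
        have : r ≤ r * n := Nat.le_mul_of_pos_right r hn1
        have : (r + 1) * n = r * n + n := by ring
        omega
      obtain ⟨h1, h2⟩ := key j hj1 hjr (by omega) (by omega)
      rw [h1] at h2
      exact Nat.eq_of_mul_eq_mul_left (show 0 < r by omega) (by rw [h2, mul_one])
  refine ⟨P.coeff 1, P.coeff 0, fun x => ?_⟩
  have h := congrArg (Polynomial.eval x) (Polynomial.eq_X_add_C_of_natDegree_le_one hn_eq.le)
  simpa [hPe] using h

/-- A permutation of the field of `p` elements that preserves the set of pairs whose difference
lies in a proper non-empty set of non-zero elements is affine. -/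
theorem exists_affine_of_preserves_differences {p : ℕ} [Fact p.Prime]
    (S : Finset (ZMod p)) (h0 : (0 : ZMod p) ∉ S) (hS : S.Nonempty)
    (hSc : ∃ c : ZMod p, c ≠ 0 ∧ c ∉ S)
    (π : Equiv.Perm (ZMod p)) (hπ : ∀ x y, y - x ∈ S ↔ π y - π x ∈ S) :
    ∃ a b : ZMod p, ∀ x, π x = a * x + b := by
  classical
  rcases le_or_gt (2 * S.card) (p - 1) with h | h
  · exact exists_affine_of_preserves_differences_of_two_mul_card_le S h0 hS h π hπ
  · obtain ⟨c, hc0, hcS⟩ := hSc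
    refine exists_affine_of_preserves_differences_of_two_mul_card_le (Finset.univ.erase 0 \ S)
      (by simp) ⟨c, by simp [hc0, hcS]⟩ ?_ π ?_
    · have hsub : S ⊆ Finset.univ.erase 0 := fun x hx => by
        simp only [Finset.mem_erase, Finset.mem_univ, and_true]
        rintro rfl
        exact h0 hx
      rw [Finset.card_sdiff_of_subset hsub, Finset.card_erase_of_mem (Finset.mem_univ _),
        Finset.card_univ, ZMod.card]
      omega
    · intro x y
      simp only [Finset.mem_sdiff, Finset.mem_erase, Finset.mem_univ, and_true, hπ x y, ne_eq,
        sub_eq_zero, π.injective.eq_iff]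

/-- Let `S` be a non-empty set of non-zero elements of the field with `p` elements that is a coset
of a multiplicative subgroup, with `S = -S`, and suppose that `S` is proper and of size greater than
`p / 3`. Then for every `w ∈ S` there are `(p - 1) / 4` elements `x ∈ S` with `x ≠ w` and
`x - w ∉ S`. -/
theorem card_filter_sub_notMem_eq {p : ℕ} [Fact p.Prime] (S : Finset (ZMod p))
    (h0 : (0 : ZMod p) ∉ S) (hneg : ∀ x ∈ S, -x ∈ S)
    (hmul : ∀ x ∈ S, ∀ y ∈ S, ∀ z ∈ S, x * y / z ∈ S)
    (hlt : S.card < p - 1) (hle : p + 1 ≤ 3 * S.card) {w : ZMod p} (hw : w ∈ S) :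
    (Finset.univ.filter fun x => x ∈ S ∧ x ≠ w ∧ x - w ∉ S).card = (p - 1) / 4 := by
  classical
  have hw0 : w ≠ 0 := fun h => h0 (h ▸ hw)
  let K : Subgroup (ZMod p)ˣ :=
    { carrier := {a | (a : ZMod p) * w ∈ S}
      mul_mem' := by
        intro a b ha hb
        have := hmul _ ha _ hb _ hw
        simp only [Set.mem_ofPred_eq, Units.val_mul]
        convert this using 1
        field_simp
      one_mem' := by simpa using hw
      inv_mem' := by
        intro a ha
        have := hmul _ hw _ hw _ ha
        simp only [Set.mem_ofPred_eq]
        convert this using 1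
        have := a.ne_zero
        rw [Units.val_inv_eq_inv_val]
        field_simp }
  have hK : ∀ a : (ZMod p)ˣ, a ∈ K ↔ (a : ZMod p) * w ∈ S := fun a => Iff.rfl
  have hKcard : Nat.card K = S.card := by
    rw [← Nat.card_eq_finsetCard]
    refine Nat.card_congr (Equiv.ofBijective (fun a : K => ⟨(a : (ZMod p)ˣ) * w, a.2⟩) ⟨?_, ?_⟩)
    · intro a b hab
      exact Subtype.ext (Units.ext (mul_right_cancel₀ hw0 (congrArg Subtype.val hab)))
    · rintro ⟨x, hx⟩
      have hx0 : x ≠ 0 := fun h => h0 (h ▸ hx)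
      refine ⟨⟨Units.mk0 (x / w) (div_ne_zero hx0 hw0), ?_⟩, ?_⟩
      · rw [hK]; simpa [hw0] using hx
      · simp [hw0]
  have hidx : K.index = 2 := by
    have h := K.card_mul_index
    rw [hKcard, Nat.card_eq_fintype_card, ZMod.card_units p] at h
    have hpos : 0 < S.card := Finset.card_pos.mpr ⟨w, hw⟩
    rcases Nat.lt_or_ge K.index 2 with h2 | h2
    · have : S.card * K.index ≤ S.card * 1 := Nat.mul_le_mul_left _ (by omega)
      omega
    · rcases Nat.eq_or_lt_of_le h2 with h3 | h3
      · exact h3.symm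
      · have : S.card * 3 ≤ S.card * K.index := Nat.mul_le_mul_left _ h3
        omega
  have hcard : p - 1 = 2 * S.card := by
    have h := K.card_mul_index
    rw [hKcard, Nat.card_eq_fintype_card, ZMod.card_units p, hidx] at h
    omega
  have hk : ∀ a b : ZMod p, a ≠ 0 → b ≠ 0 → (a * b * w ∈ S ↔ (a * w ∈ S ↔ b * w ∈ S)) :=
    fun a b ha hb =>
      Subgroup.mul_mem_iff_of_index_two hidx (a := Units.mk0 a ha) (b := Units.mk0 b hb)
  have hk0 : (0 : ZMod p) * w ∉ S := by simpa using h0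
  have hk1 : (1 : ZMod p) * w ∈ S := by simpa using hw
  have hkneg : ∀ a : ZMod p, -a * w ∈ S ↔ a * w ∈ S := fun a =>
    ⟨fun h => by simpa using hneg _ h, fun h => by simpa using hneg _ h⟩
  have hkinv : ∀ a : ZMod p, a⁻¹ * w ∈ S ↔ a * w ∈ S := by
    intro a
    rcases eq_or_ne a 0 with rfl | ha
    · simp
    · have := hk a a⁻¹ ha (inv_ne_zero ha)
      rw [mul_inv_cancel₀ ha] at this
      tauto
  set A := Finset.univ.filter fun t : ZMod p => t * w ∈ S ∧ t ≠ 1 ∧ (t - 1) * w ∉ S with hA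
  set B := Finset.univ.filter fun t : ZMod p => t ≠ 0 ∧ t * w ∉ S ∧ (t - 1) * w ∈ S with hB
  set C := Finset.univ.filter fun t : ZMod p => t ≠ 0 ∧ t * w ∉ S ∧ (t - 1) * w ∉ S with hC
  have h1 : (Finset.univ.filter fun x => x ∈ S ∧ x ≠ w ∧ x - w ∉ S).card = A.card := by
    refine Finset.card_bij' (fun x _ => x / w) (fun t _ => t * w) ?_ ?_ ?_ ?_
    · intro x hx
      simp only [hA, Finset.mem_filter, Finset.mem_univ, true_and] at hx ⊢
      rw [sub_mul, one_mul, div_mul_cancel₀ _ hw0, ne_eq, div_eq_one_iff_eq hw0]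
      exact hx
    · intro t ht
      simp only [hA, Finset.mem_filter, Finset.mem_univ, true_and] at ht ⊢
      rw [sub_mul, one_mul] at ht
      refine ⟨ht.1, ?_, ht.2.2⟩
      rw [ne_eq, mul_eq_right₀ hw0]
      exact ht.2.1
    · intro x _
      exact div_mul_cancel₀ _ hw0
    · intro t _
      exact mul_div_cancel_right₀ _ hw0
  have h2 : A.card = B.card := by
    have hflip : ∀ t : ZMod p, (1 - t) * w ∈ S ↔ (t - 1) * w ∈ S := fun t => by
      rw [← hkneg, neg_sub]
    refine Finset.card_bij' (fun t _ => 1 - t) (fun t _ => 1 - t) ?_ ?_ ?_ ?_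
    · intro t ht
      simp only [hA, hB, Finset.mem_filter, Finset.mem_univ, true_and] at ht ⊢
      rw [hflip, sub_sub_cancel_left, hkneg, sub_ne_zero]
      exact ⟨ht.2.1.symm, ht.2.2, ht.1⟩
    · intro t ht
      simp only [hA, hB, Finset.mem_filter, Finset.mem_univ, true_and] at ht ⊢
      rw [hflip, sub_sub_cancel_left, hkneg, ne_eq, sub_eq_self]
      exact ⟨ht.2.2, ht.1, ht.2.1⟩
    · intro t _
      exact sub_sub_cancel _ _
    · intro t _
      exact sub_sub_cancel _ _
  have h3 : B.card = C.card := by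
    have hinv : ∀ t : ZMod p, t ≠ 0 → t * w ∉ S →
        ((t⁻¹ - 1) * w ∈ S ↔ ¬ (t - 1) * w ∈ S) := by
      intro t ht0 ht
      have ht1 : t - 1 ≠ 0 := by
        rintro h
        rw [sub_eq_zero.mp h] at ht
        exact ht hk1
      have : t⁻¹ - 1 = t⁻¹ * -(t - 1) := by
        field_simp
        ring
      rw [this, hk _ _ (inv_ne_zero ht0) (neg_ne_zero.mpr ht1), hkneg, hkinv]
      tauto
    refine Finset.card_bij' (fun t _ => t⁻¹) (fun t _ => t⁻¹) ?_ ?_ ?_ ?_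
    · intro t ht
      simp only [hB, hC, Finset.mem_filter, Finset.mem_univ, true_and] at ht ⊢
      rw [hinv t ht.1 ht.2.1, hkinv, not_not]
      exact ⟨inv_ne_zero ht.1, ht.2.1, ht.2.2⟩
    · intro t ht
      simp only [hB, hC, Finset.mem_filter, Finset.mem_univ, true_and] at ht ⊢
      rw [hinv t ht.1 ht.2.1, hkinv]
      exact ⟨inv_ne_zero ht.1, ht.2.1, ht.2.2⟩
    · intro t _
      exact inv_inv t
    · intro t _
      exact inv_inv t
  have h4 : B.card + C.card = (Finset.univ.erase 0 \ S).card := by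
    have hdisj : Disjoint B C := by
      rw [Finset.disjoint_left]
      intro t ht ht'
      simp only [hB, hC, Finset.mem_filter] at ht ht'
      exact ht'.2.2.2 ht.2.2.2
    rw [← Finset.card_union_of_disjoint hdisj]
    refine Finset.card_bij' (fun t _ => t * w) (fun x _ => x / w) ?_ ?_ ?_ ?_
    · intro t ht
      simp only [hB, hC, Finset.mem_union, Finset.mem_filter, Finset.mem_univ, true_and,
        Finset.mem_sdiff, Finset.mem_erase, and_true] at ht ⊢
      have := hw0
      rw [ne_eq, mul_eq_zero]
      tauto
    · intro x hx
      simp only [hB, hC, Finset.mem_union, Finset.mem_filter, Finset.mem_univ, true_and,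
        Finset.mem_sdiff, Finset.mem_erase, and_true] at hx ⊢
      have := div_ne_zero hx.1 hw0
      rw [div_mul_cancel₀ _ hw0]
      tauto
    · intro t _
      exact mul_div_cancel_right₀ _ hw0
    · intro x _
      exact div_mul_cancel₀ _ hw0
  have hsub : S ⊆ Finset.univ.erase 0 := fun x hx => by
    simp only [Finset.mem_erase, Finset.mem_univ, and_true]
    rintro rfl
    exact h0 hx
  rw [Finset.card_sdiff_of_subset hsub, Finset.card_erase_of_mem (Finset.mem_univ _),
    Finset.card_univ, ZMod.card] at h4
  omega

theorem exists_equiv_zmod_of_transitive {α : Type*} [Finite α] {p : ℕ} [Fact p.Prime]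
    (hα : Nat.card α = p) (H : Subgroup (Equiv.Perm α)) (hH : ∀ x y : α, ∃ σ ∈ H, σ x = y) :
    ∃ e : ZMod p ≃ α, ∃ σ ∈ H, ∀ i, e (i + 1) = σ (e i) := by
  have hp : p.Prime := Fact.out
  have : Nonempty α := (Nat.card_pos_iff.mp (hα ▸ hp.pos)).1
  obtain ⟨x⟩ := this
  have htr : MulAction.IsPretransitive H α :=
    ⟨fun x y => by
      obtain ⟨σ, hσ, h⟩ := hH x y
      exact ⟨⟨σ, hσ⟩, h⟩⟩
  have hdvd : p ∣ Nat.card H := by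
    rw [← hα, ← MulAction.index_stabilizer_of_transitive H x]
    exact Subgroup.index_dvd_card _
  obtain ⟨⟨σ, hσ⟩, hord⟩ := exists_prime_orderOf_dvd_card' p hdvd
  rw [Subgroup.orderOf_mk] at hord
  have hσ1 : σ ≠ 1 := by
    rintro rfl
    rw [orderOf_one] at hord
    exact hp.one_lt.ne hord
  obtain ⟨y, hy⟩ : ∃ y, σ y ≠ y := by
    by_contra! h
    exact hσ1 (Equiv.ext h)
  have hper : Function.minimalPeriod σ y = p := by
    refine Function.minimalPeriod_eq_prime ?_ hy
    rw [Function.IsPeriodicPt, Function.IsFixedPt, ← Equiv.Perm.coe_pow, ← hord, pow_orderOf_eq_one]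
    rfl
  have hinj : Function.Injective fun i : ZMod p => σ^[i.val] y := by
    intro i j hij
    rw [Function.iterate_eq_iterate_iff_of_lt_minimalPeriod (hper ▸ ZMod.val_lt i)
      (hper ▸ ZMod.val_lt j)] at hij
    exact ZMod.val_injective p hij
  have hbij : Function.Bijective fun i : ZMod p => σ^[i.val] y :=
    hinj.bijective_of_nat_card_le (by rw [hα, Nat.card_zmod])
  refine ⟨Equiv.ofBijective _ hbij, σ, hσ, fun i => ?_⟩
  simp only [Equiv.ofBijective_apply]
  rw [← Function.iterate_succ_apply' σ, ZMod.val_add, ZMod.val_one]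
  have h := Function.iterate_mod_minimalPeriod_eq (f := σ) (x := y) (n := i.val + 1)
  rwa [hper] at h

/-- The neighbourhood of a vertex of prime valency `p` in an arc-transitive graph can be labelled by
`ZMod p` in such a way that all translations are induced by automorphisms. -/
theorem exists_neighborSet_labelling {V : Type*} [Finite V] {Γ : SimpleGraph V} {p : ℕ}
    [Fact p.Prime] (harc : ArcTransitive Γ) {v u : V} (hcard : Nat.card (Γ.neighborSet u) = p)
    (hvu : Γ.Adj v u) :
    ∃ e : ZMod p → V, Function.Injective e ∧ e 0 = v ∧ (∀ x, Γ.Adj u x ↔ ∃ i, e i = x) ∧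
      ∀ c, ∃ φ : Γ ≃g Γ, φ u = u ∧ ∀ i, φ (e i) = e (i + c) := by
  let H : Subgroup (Equiv.Perm (Γ.neighborSet u)) :=
    { carrier := {σ | ∃ φ : Γ ≃g Γ, φ u = u ∧ ∀ x : Γ.neighborSet u, φ x = σ x}
      mul_mem' := by
        rintro σ τ ⟨φ, hφ, hφ'⟩ ⟨ψ, hψ, hψ'⟩
        refine ⟨ψ.trans φ, ?_, fun x => ?_⟩
        · simp [hφ, hψ]
        · simp [hφ', hψ']
      one_mem' := ⟨RelIso.refl _, rfl, fun _ => rfl⟩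
      inv_mem' := by
        rintro σ ⟨φ, hφ, hφ'⟩
        refine ⟨φ.symm, ?_, fun x => ?_⟩
        · rw [RelIso.symm_apply_eq, hφ]
        · rw [RelIso.symm_apply_eq, hφ']
          simp }
  have hH : ∀ x y : Γ.neighborSet u, ∃ σ ∈ H, σ x = y := by
    intro x y
    obtain ⟨φ, hφ, hxy⟩ := harc x.2 y.2
    have hmem : ∀ z, z ∈ Γ.neighborSet u ↔ φ.toEquiv z ∈ Γ.neighborSet u := by
      intro z
      have := φ.map_adj_iff (v := u) (w := z)
      rw [hφ] at this
      exact this.symm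
    refine ⟨φ.toEquiv.subtypeEquiv hmem, ⟨φ, hφ, fun z => rfl⟩, Subtype.ext hxy⟩
  obtain ⟨e, σ, ⟨φ, hφ, hφσ⟩, hσ⟩ := exists_equiv_zmod_of_transitive hcard H hH
  have hstep : ∀ i, φ (e i) = e (i + 1) := fun i => by rw [hφσ, hσ]
  have htrans : ∀ n : ℕ, ∃ ψ : Γ ≃g Γ, ψ u = u ∧ ∀ i, ψ (e i) = e (i + (n : ZMod p)) := by
    intro n
    induction n with
    | zero => exact ⟨RelIso.refl _, rfl, fun i => by simp⟩
    | succ n ih =>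
      obtain ⟨ψ, hψ, hψ'⟩ := ih
      refine ⟨ψ.trans φ, ?_, fun i => ?_⟩
      · simp [hφ, hψ]
      · rw [RelIso.trans_apply, hψ', hstep]
        push_cast
        rw [add_assoc]
  set a := e.symm ⟨v, hvu.symm⟩ with ha
  refine ⟨fun i => e (i + a), ?_, ?_, ?_, ?_⟩
  · intro i j hij
    exact add_right_cancel (e.injective (Subtype.ext hij))
  · simp [ha]
  · intro x
    constructor
    · intro hx
      exact ⟨e.symm ⟨x, hx⟩ - a, by simp⟩
    · rintro ⟨i, rfl⟩
      exact (e (i + a)).2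
  · intro c
    obtain ⟨ψ, hψ, hψ'⟩ := htrans c.val
    refine ⟨ψ, hψ, fun i => ?_⟩
    rw [hψ', ZMod.natCast_zmod_val, add_right_comm]

open Classical in
/-- Double counting of the edges between `Γ_1(v)` and `Γ_2(v)`. -/
theorem TwoGeodesicTransitive.card_mul_card_eq {V : Type*} [Fintype V] {Γ : SimpleGraph V}
    (h : TwoGeodesicTransitive Γ) {v u w : V} (hg : Is2Geodesic Γ v u w) :
    (Finset.univ.filter fun x => Γ.Adj v x).card *
        (Finset.univ.filter fun x => Γ.Adj u x ∧ v ≠ x ∧ ¬ Γ.Adj v x).card =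
      (Finset.univ.filter fun x => v ≠ x ∧ ¬ Γ.Adj v x ∧ ∃ y, Γ.Adj v y ∧ Γ.Adj y x).card *
        (Finset.univ.filter fun x => Γ.Adj v x ∧ Γ.Adj w x).card := by
  refine Finset.card_mul_eq_card_mul Γ.Adj ?_ ?_
  · intro y hy
    simp only [Finset.mem_filter, Finset.mem_univ, true_and] at hy
    obtain ⟨φ, hv, hu⟩ := h.1 hy hg.1
    refine Finset.card_equiv φ.toEquiv fun x => ?_
    have h1 : Γ.Adj u (φ x) ↔ Γ.Adj y x := by rw [← hu, φ.map_adj_iff]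
    have h2 : Γ.Adj v (φ x) ↔ Γ.Adj v x := by
      conv_lhs => rw [← hv]
      exact φ.map_adj_iff
    have h3 : v = φ x ↔ v = x := by
      conv_lhs => rw [← hv]
      exact φ.injective.eq_iff
    simp only [Finset.bipartiteAbove, Finset.mem_filter, Finset.mem_univ, true_and,
      RelIso.coe_fn_toEquiv, h1, h2, h3, ne_eq]
    constructor
    · rintro ⟨⟨h4, h5, -⟩, h6⟩
      exact ⟨h6, h4, h5⟩
    · rintro ⟨h6, h4, h5⟩
      exact ⟨⟨h4, h5, y, hy, h6⟩, h6⟩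
  · intro x hx
    simp only [Finset.mem_filter, Finset.mem_univ, true_and] at hx
    obtain ⟨hvx, hnvx, y, hvy, hyx⟩ := hx
    obtain ⟨φ, hv, -, hx⟩ := h.2 ⟨hvy, hyx, hvx, hnvx⟩ hg
    refine Finset.card_equiv φ.toEquiv fun z => ?_
    have h1 : Γ.Adj w (φ z) ↔ Γ.Adj z x := by rw [← hx, φ.map_adj_iff, Γ.adj_comm]
    have h2 : Γ.Adj v (φ z) ↔ Γ.Adj v z := by
      conv_lhs => rw [← hv]
      exact φ.map_adj_iff
    simp only [Finset.bipartiteBelow, Finset.mem_filter, Finset.mem_univ, true_and,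
      RelIso.coe_fn_toEquiv, h1, h2]

/-- If a set of residues is contained in its translate by a non-zero element, then it is empty or
contains zero. -/
theorem zero_mem_of_sub_mem {p : ℕ} [Fact p.Prime] {C : Set (ZMod p)} {c d : ZMod p} (hc : c ∈ C)
    (hd : d ≠ 0) (hC : ∀ x ∈ C, x - d ∈ C) : (0 : ZMod p) ∈ C := by
  have h : ∀ n : ℕ, c - n * d ∈ C := by
    intro n
    induction n with
    | zero => simpa using hc
    | succ n ih =>
      convert hC _ ih using 1
      push_cast
      ring
  have := h (c / d).val
  rwa [ZMod.natCast_zmod_val, div_mul_cancel₀ _ hd, sub_self] at this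

theorem exists_triangle_of_not_twoArcTransitive {V : Type*} {Γ : SimpleGraph V}
    (h : TwoGeodesicTransitive Γ) (hn : ¬ TwoArcTransitive Γ) {v u : V} (hvu : Γ.Adj v u) :
    ∃ x, Γ.Adj u x ∧ Γ.Adj v x := by
  by_contra! hcon
  have hno : ∀ ⦃a b c : V⦄, Is2Arc Γ a b c → Is2Geodesic Γ a b c := by
    rintro a b c ⟨hab, hbc, hac⟩
    refine ⟨hab, hbc, hac, fun hadj => ?_⟩
    obtain ⟨φ, ha, hb⟩ := h.1 hab hvu
    refine hcon (φ c) ?_ ?_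
    · rw [← hb]; exact φ.map_adj_iff.mpr hbc
    · rw [← ha]; exact φ.map_adj_iff.mpr hadj
  exact hn ⟨h.1, fun _ _ _ _ _ _ h1 h2 => h.2 (hno h1) (hno h2)⟩

theorem dist_eq_two_iff_of_adj_adj {V : Type*} {Γ : SimpleGraph V} {v u x : V} (hvu : Γ.Adj v u)
    (hux : Γ.Adj u x) : Γ.dist v x = 2 ↔ v ≠ x ∧ ¬ Γ.Adj v x := by
  have hle : Γ.dist v x ≤ 2 := SimpleGraph.dist_le (.cons hvu (.cons hux .nil))
  have hr : Γ.Reachable v x := hvu.reachable.trans hux.reachable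
  rw [← SimpleGraph.dist_eq_one_iff_adj, ne_eq, ← hr.dist_eq_zero_iff]
  omega

theorem stmt7 {V : Type*} [Fintype V] (Γ : SimpleGraph V) (p : ℕ)
    (hp : p.Prime)
    (hreg : ∀ v : V, Nat.card (Γ.neighborSet v) = p)
    (hconn : Γ.Connected)
    (hnc : Γ ≠ ⊤)
    (h2gt : TwoGeodesicTransitive Γ)
    (h2at : ¬ TwoArcTransitive Γ) :
    ∀ v u w : V, Is2Geodesic Γ v u w →
      Nat.card {x : V | Γ.dist v x = 2 ∧ Γ.Adj u x ∧ Γ.Adj w x} = (p - 1) / 4 := by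
  classical
  intro v u w hg
  have : Fact p.Prime := ⟨hp⟩
  obtain ⟨e, he, rfl, heu, htr⟩ := exists_neighborSet_labelling h2gt.1 (hreg u) hg.1
  obtain ⟨d, rfl⟩ := (heu w).mp hg.2.1
  have heu' : ∀ i, Γ.Adj u (e i) := fun i => (heu _).mpr ⟨i, rfl⟩
  set S := Finset.univ.filter fun i : ZMod p => i ≠ 0 ∧ ¬ Γ.Adj (e 0) (e i) with hS
  have hmemS : ∀ i, i ∈ S ↔ i ≠ 0 ∧ ¬ Γ.Adj (e 0) (e i) := fun i => by simp [hS]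
  have hdiff : ∀ x y, y - x ∈ S ↔ y ≠ x ∧ ¬ Γ.Adj (e x) (e y) := by
    intro x y
    obtain ⟨φ, -, hφ⟩ := htr x
    have h1 := hφ 0
    have h2 := hφ (y - x)
    rw [zero_add] at h1
    rw [sub_add_cancel] at h2
    rw [hmemS, sub_ne_zero, ← h1, ← h2, φ.map_adj_iff]
  have hadj : ∀ x y, Γ.Adj (e x) (e y) ↔ y ≠ x ∧ y - x ∉ S := by
    intro x y
    rw [hdiff]
    have : Γ.Adj (e x) (e y) → y ≠ x := fun h h' => Γ.irrefl (h' ▸ h)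
    tauto
  have hgeo : ∀ i ∈ S, Is2Geodesic Γ (e 0) u (e i) := fun i hi =>
    ⟨(heu' 0).symm, heu' i, he.ne ((hmemS i).mp hi).1.symm, ((hmemS i).mp hi).2⟩
  have h0 : (0 : ZMod p) ∉ S := fun h => ((hmemS 0).mp h).1 rfl
  have hd : d ∈ S := (hmemS d).mpr ⟨fun h => hg.2.2.1 (h ▸ rfl), hg.2.2.2⟩
  have hd0 : d ≠ 0 := fun h => h0 (h ▸ hd)
  have hneg : ∀ x ∈ S, -x ∈ S := by
    intro x hx
    rw [hmemS] at hx
    rw [← zero_sub, hdiff, Γ.adj_comm]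
    exact ⟨hx.1.symm, hx.2⟩
  have hSc : ∃ c : ZMod p, c ≠ 0 ∧ c ∉ S := by
    obtain ⟨x, hux, hvx⟩ := exists_triangle_of_not_twoArcTransitive h2gt h2at hg.1
    obtain ⟨c, rfl⟩ := (heu x).mp hux
    exact ⟨c, by simpa using (hadj 0 c).mp hvx⟩
  have hmul : ∀ x ∈ S, ∀ y ∈ S, ∀ z ∈ S, x * y / z ∈ S := by
    intro x hx y hy z hz
    obtain ⟨φ, hφ0, hφu, hφz⟩ := h2gt.2 (hgeo z hz) (hgeo y hy)
    have hex : ∀ i, ∃ j, e j = φ (e i) := fun i => by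
      rw [← heu]
      conv_lhs => rw [← hφu]
      exact φ.map_adj_iff.mpr (heu' i)
    choose π hπ using hex
    have hπinj : Function.Injective π := fun i j hij =>
      he (φ.injective (by rw [← hπ, ← hπ, hij]))
    obtain ⟨a, b, hab⟩ := exists_affine_of_preserves_differences S h0 ⟨d, hd⟩ hSc
      (Equiv.ofBijective π (Finite.injective_iff_bijective.mp hπinj)) (fun i j => by
        simp only [Equiv.ofBijective_apply]
        rw [hdiff, hdiff, hπ, hπ, φ.map_adj_iff, hπinj.ne_iff])
    simp only [Equiv.ofBijective_apply] at hab
    have hπ0 : π 0 = 0 := he (by rw [hπ, hφ0])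
    have hπz : π z = y := he (by rw [hπ, hφz])
    have hb : b = 0 := by simpa [hπ0] using (hab 0).symm
    have hz0 : z ≠ 0 := ((hmemS z).mp hz).1
    have ha : a = y / z := by
      rw [eq_div_iff hz0, ← hπz, hab, hb, add_zero]
    have hπx : π x = x * y / z := by
      rw [hab, hb, ha]
      ring
    have hφ0' : e 0 = φ (e 0) := hφ0.symm
    rw [hmemS, ← hπx]
    refine ⟨fun h => ((hmemS x).mp hx).1 (hπinj (h.trans hπ0.symm)), ?_⟩
    rw [hπ, hφ0', φ.map_adj_iff]
    exact ((hmemS x).mp hx).2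
  have hlt : S.card < p - 1 := by
    have hsub : S ⊆ Finset.univ.erase 0 := fun x hx => by
      simp only [Finset.mem_erase, Finset.mem_univ, and_true]
      exact ((hmemS x).mp hx).1
    have hss : S ⊂ Finset.univ.erase 0 := by
      obtain ⟨c, hc0, hc⟩ := hSc
      exact Finset.ssubset_iff_subset_ne.mpr ⟨hsub, fun h => hc (h ▸ by simp [hc0])⟩
    have := Finset.card_lt_card hss
    rwa [Finset.card_erase_of_mem (Finset.mem_univ _), Finset.card_univ, ZMod.card] at this
  set M := Finset.univ.filter fun x => Γ.Adj (e 0) x ∧ Γ.Adj (e d) x with hM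
  have hMlower : p + 1 ≤ M.card + 2 * S.card := by
    set T := insert 0 S with hT
    set T' := T.image fun i => i + d with hT'
    have hTc : T.card = S.card + 1 := Finset.card_insert_of_notMem h0
    have hT'c : T'.card = S.card + 1 := by
      rw [hT', Finset.card_image_of_injective _ (add_left_injective d), hTc]
    have hinter : 2 ≤ (T ∩ T').card := by
      rw [← Finset.card_pair hd0.symm]
      refine Finset.card_le_card fun x hx => ?_
      simp only [Finset.mem_insert, Finset.mem_singleton] at hx
      rw [Finset.mem_inter, hT', Finset.mem_image]
      rcases hx with rfl | rfl
      · exact ⟨by simp [hT], -d, by simp [hT, hneg d hd], by simp⟩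
      · exact ⟨by simp [hT, hd], 0, by simp [hT], by simp⟩
    have hunion := Finset.card_union_add_card_inter T T'
    have hcompl := Finset.card_compl_add_card (T ∪ T')
    rw [ZMod.card] at hcompl
    have hle : (insert u ((T ∪ T')ᶜ.image e)).card ≤ M.card := by
      refine Finset.card_le_card fun x hx => ?_
      rw [hM, Finset.mem_filter]
      refine ⟨Finset.mem_univ _, ?_⟩
      rw [Finset.mem_insert, Finset.mem_image] at hx
      rcases hx with rfl | ⟨i, hi, rfl⟩
      · exact ⟨hg.1, hg.2.1.symm⟩
      · rw [Finset.mem_compl, Finset.mem_union, not_or] at hi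
        have h1 : i ≠ 0 ∧ i ∉ S := by simpa [hT] using hi.1
        have h2 : i - d ∉ T := fun h =>
          hi.2 (Finset.mem_image.mpr ⟨i - d, h, sub_add_cancel _ _⟩)
        have h3 : i - d ≠ 0 ∧ i - d ∉ S := by simpa [hT] using h2
        rw [hadj, hadj, sub_zero, ← sub_ne_zero (b := d)]
        exact ⟨h1, h3⟩
    rw [Finset.card_insert_of_notMem, Finset.card_image_of_injective _ he] at hle
    · omega
    · intro h
      obtain ⟨i, -, hi⟩ := Finset.mem_image.mp h
      exact Γ.irrefl (hi ▸ heu' i)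
  have hdeg : (Finset.univ.filter fun x => Γ.Adj (e 0) x).card = p := by
    refine Eq.trans ?_ (hreg (e 0))
    rw [Nat.card_eq_fintype_card, ← Set.toFinset_card]
    congr 1
    ext x
    simp
  have hMlt : M.card < p := by
    have hMsub : M ⊆ Finset.univ.filter fun x => Γ.Adj (e 0) x := fun x hx => by
      simp only [hM, Finset.mem_filter] at hx ⊢
      exact ⟨hx.1, hx.2.1⟩
    refine lt_of_le_of_ne (hdeg ▸ Finset.card_le_card hMsub) fun heq => ?_
    have hMeq := Finset.eq_of_subset_of_card_le hMsub (by rw [hdeg, heq])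
    obtain ⟨c, hc⟩ := hSc
    have hzero := zero_mem_of_sub_mem (C := {i : ZMod p | i ≠ 0 ∧ i ∉ S}) hc hd0 (by
      intro i hi
      have h1 : e i ∈ M := by
        rw [hMeq, Finset.mem_filter, hadj, sub_zero]
        exact ⟨Finset.mem_univ _, hi⟩
      have h2 := (Finset.mem_filter.mp h1).2.2
      rw [hadj, ← sub_ne_zero] at h2
      exact h2)
    exact hzero.1 rfl
  have hMle : M.card ≤ S.card := by
    have hcount := h2gt.card_mul_card_eq hg
    have hSe : (Finset.univ.filter fun x => Γ.Adj u x ∧ e 0 ≠ x ∧ ¬ Γ.Adj (e 0) x).card =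
        S.card := by
      rw [← Finset.card_image_of_injective S he]
      congr 1
      ext x
      simp only [Finset.mem_filter, Finset.mem_univ, true_and, Finset.mem_image, hmemS]
      constructor
      · rintro ⟨hux, hx0, hx⟩
        obtain ⟨i, rfl⟩ := (heu x).mp hux
        exact ⟨i, ⟨fun h => hx0 (h ▸ rfl), hx⟩, rfl⟩
      · rintro ⟨i, ⟨hi0, hi⟩, rfl⟩
        exact ⟨heu' i, he.ne hi0.symm, hi⟩
    rw [hdeg, hSe, ← hM] at hcount
    set n := (Finset.univ.filter fun x => e 0 ≠ x ∧ ¬ Γ.Adj (e 0) x ∧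
      ∃ y, Γ.Adj (e 0) y ∧ Γ.Adj y x).card with hn
    have hSpos : 0 < S.card := Finset.card_pos.mpr ⟨d, hd⟩
    have hMpos : 0 < M.card := by
      refine Nat.pos_of_ne_zero fun h => ?_
      rw [h, mul_zero] at hcount
      exact (Nat.mul_pos hp.pos hSpos).ne' hcount
    have hpn : p ∣ n :=
      (hp.dvd_mul.mp (hcount ▸ dvd_mul_right p _)).resolve_right
        (Nat.not_dvd_of_pos_of_lt hMpos hMlt)
    have hnpos : 0 < n := by
      refine Nat.pos_of_ne_zero fun h => ?_
      rw [h, zero_mul] at hcount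
      exact (Nat.mul_pos hp.pos hSpos).ne' hcount
    refine le_of_mul_le_mul_left (a := p) ?_ hp.pos
    rw [hcount]
    exact Nat.mul_le_mul_right _ (Nat.le_of_dvd hnpos hpn)
  rw [← card_filter_sub_notMem_eq S h0 hneg hmul hlt (by omega) hd,
    ← Finset.card_image_of_injective _ he, Nat.card_eq_fintype_card, ← Set.toFinset_card]
  congr 1
  ext x
  simp only [Set.mem_toFinset, Set.mem_ofPred_eq, Finset.mem_image, Finset.mem_filter,
    Finset.mem_univ, true_and]
  constructor
  · rintro ⟨hdist, hux, hwx⟩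
    rw [dist_eq_two_iff_of_adj_adj hg.1 hux] at hdist
    obtain ⟨i, rfl⟩ := (heu x).mp hux
    exact ⟨i, ⟨(hmemS i).mpr ⟨fun h => hdist.1 (h ▸ rfl), hdist.2⟩, (hadj d i).mp hwx⟩, rfl⟩
  · rintro ⟨i, ⟨hi, hid⟩, rfl⟩
    rw [dist_eq_two_iff_of_adj_adj hg.1 (heu' i)]
    exact ⟨⟨(hgeo i hi).2.2.1, (hgeo i hi).2.2.2⟩, heu' i, (hadj d i).mpr hid⟩
end

section
/- Let Γ be a finite connected non-complete graph of prime valency p that is 2-geodesic transitive but not 2-arc transitive. Then for every 2-geodesic (v,u,w) of Γ, the number of neighbours of w that are at distance 2 from v equals (p-1)/2. -/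
open SimpleGraph

/-- The `k`-th power of the shift matrix on `ZMod p`. -/
theorem shift_matrix_pow {p : ℕ} [NeZero p] {R : Type*} [CommRing R] (k : ℕ) :
    (Matrix.of fun x y : ZMod p => if y - x = 1 then (1 : R) else 0) ^ k =
      Matrix.of fun x y : ZMod p => if y - x = k then (1 : R) else 0 := by
  induction k with
  | zero =>
    ext x y
    simp [Matrix.one_apply, sub_eq_zero, eq_comm]
  | succ k ih =>
    rw [pow_succ, ih]
    ext x y
    simp only [Matrix.mul_apply, Matrix.of_apply]
    rw [Finset.sum_eq_single (x + k)]
    · simp [sub_eq_iff_eq_add, add_comm, ← add_assoc]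
    · intro z _ hz
      have : z - x ≠ k := fun h => hz (by rw [← h]; ring)
      simp [this]
    · simp

theorem cayley_matrix_pow_prime {p q : ℕ} [Fact p.Prime] [Fact q.Prime] (hpq : q ≠ p)
    (S : Finset (ZMod p)) :
    (Matrix.of fun x y : ZMod p => if y - x ∈ S then (1 : ZMod q) else 0) ^ q =
      Matrix.of fun x y : ZMod p =>
        if y - x ∈ S.image (fun s => (q : ZMod p) * s) then (1 : ZMod q) else 0 := by
  set P : Matrix (ZMod p) (ZMod p) (ZMod q) :=
    Matrix.of fun x y : ZMod p => if y - x = 1 then (1 : ZMod q) else 0 with hP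
  set f : Polynomial (ZMod q) := ∑ s ∈ S, Polynomial.X ^ s.val with hf
  have hq0 : (q : ZMod p) ≠ 0 := by
    rw [Ne, ZMod.natCast_eq_zero_iff]
    exact fun h => hpq ((Nat.prime_dvd_prime_iff_eq Fact.out Fact.out).1 h).symm
  have h1 : (Matrix.of fun x y : ZMod p => if y - x ∈ S then (1 : ZMod q) else 0) =
      Polynomial.aeval P f := by
    ext x y
    simp [hf, hP, shift_matrix_pow, Matrix.sum_apply]
  rw [h1, ← map_pow, ← ZMod.expand_card]
  ext x y
  simp only [hf, hP, map_sum, map_pow, Polynomial.expand_X, Polynomial.aeval_X, ← pow_mul,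
    shift_matrix_pow, Matrix.sum_apply, Matrix.of_apply, Nat.cast_mul, ZMod.natCast_val,
    ZMod.cast_id', id]
  rw [← Finset.sum_image (s := S) (g := fun s => (q : ZMod p) * s)
    (f := fun z => if y - x = z then (1 : ZMod q) else 0)]
  · simp
  · intro a _ b _ hab
    exact mul_left_cancel₀ hq0 hab

/-- Schur's multiplier theorem for prime order. -/
theorem preserves_image_mul {p : ℕ} [Fact p.Prime] (φ : Equiv.Perm (ZMod p)) (t : ℕ) :
    ∀ (S : Finset (ZMod p)), (∀ x y, φ y - φ x ∈ S ↔ y - x ∈ S) → (t : ZMod p) ≠ 0 →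
      ∀ x y, φ y - φ x ∈ S.image (fun s => (t : ZMod p) * s) ↔
        y - x ∈ S.image (fun s => (t : ZMod p) * s) := by
  induction t using Nat.recOnMul with
  | zero => simp
  | one => simp
  | prime q hq =>
    intro S hS hq0 x y
    have := Fact.mk hq
    have hpq : q ≠ p := by rintro rfl; simp at hq0
    have hM := cayley_matrix_pow_prime hpq S
    set M := Matrix.of fun x y : ZMod p => if y - x ∈ S then (1 : ZMod q) else 0 with hMdef
    have hφ : Matrix.reindexAlgEquiv (ZMod q) (ZMod q) φ.symm M = M := by
      ext x y
      simp [hMdef, hS]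
    have hφ' : Matrix.reindexAlgEquiv (ZMod q) (ZMod q) φ.symm (M ^ q) = M ^ q := by
      rw [map_pow, hφ]
    have h := congrFun (congrFun hφ' x) y
    rw [hM] at h
    simp only [Matrix.coe_reindexAlgEquiv, Matrix.reindex_apply, Matrix.submatrix_apply,
      Matrix.of_apply, Equiv.symm_symm] at h
    by_cases h1 : φ y - φ x ∈ S.image (fun s => (q : ZMod p) * s) <;>
      by_cases h2 : y - x ∈ S.image (fun s => (q : ZMod p) * s) <;>
      simp only [h1, h2, if_true, if_false, one_ne_zero, zero_ne_one] at h ⊢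
  | mul a b iha ihb =>
    intro S hS hab x y
    rw [Nat.cast_mul] at hab
    have := iha _ (ihb S hS (right_ne_zero_of_mul hab)) (left_ne_zero_of_mul hab) x y
    simpa [Finset.image_image, Function.comp_def, mul_assoc] using this

theorem image_mul_eq_of_orbit {p : ℕ} [Fact p.Prime] {S : Finset (ZMod p)}
    (htr : ∀ s ∈ S, ∀ s' ∈ S, ∃ φ : Equiv.Perm (ZMod p),
      (∀ x y, φ y - φ x ∈ S ↔ y - x ∈ S) ∧ φ 0 = 0 ∧ φ s = s')
    {t s : ZMod p} (ht : t ≠ 0) (hs : s ∈ S) (hts : t * s ∈ S) :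
    S.image (fun x => t * x) = S := by
  symm
  apply Finset.eq_of_subset_of_card_le
  · intro s' hs'
    obtain ⟨φ, hφ, h0, h1⟩ := htr _ hts _ hs'
    have hcast : ((t.val : ℕ) : ZMod p) = t := by simp
    have := preserves_image_mul φ t.val S hφ (by rwa [hcast]) 0 (t * s)
    rw [hcast, h0, h1, sub_zero, sub_zero] at this
    exact this.2 (Finset.mem_image_of_mem _ hs)
  · exact Finset.card_image_le

theorem card_dvd_of_image_mul_eq {p : ℕ} [Fact p.Prime] {S : Finset (ZMod p)}
    (hmul : ∀ t s : ZMod p, t ≠ 0 → s ∈ S → t * s ∈ S → S.image (fun x => t * x) = S)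
    (h0 : 0 ∉ S) (hne : S.Nonempty) : S.card ∣ p - 1 := by
  obtain ⟨s₀, hs₀⟩ := hne
  have hs₀0 : s₀ ≠ 0 := fun h => h0 (h ▸ hs₀)
  let H : Subgroup (ZMod p)ˣ :=
    { carrier := {t | (t : ZMod p) * s₀ ∈ S}
      mul_mem' := by
        intro a b ha hb
        have := hmul a s₀ a.ne_zero hs₀ ha
        have h2 := Finset.mem_image_of_mem (fun x => (a : ZMod p) * x) hb
        rw [this] at h2
        simpa [mul_assoc] using h2
      one_mem' := by simpa using hs₀
      inv_mem' := by
        intro a ha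
        have := hmul a s₀ a.ne_zero hs₀ ha
        have h2 := hs₀
        rw [← this, Finset.mem_image] at h2
        obtain ⟨x, hx, hxs⟩ := h2
        change ((a⁻¹ : (ZMod p)ˣ) : ZMod p) * s₀ ∈ S
        rw [← hxs, Units.inv_mul_cancel_left]
        exact hx }
  have hcard : Nat.card H = S.card := by
    have hS : S.card = Nat.card S := by simp
    rw [hS]
    refine Nat.card_congr (Equiv.ofBijective (fun t => ⟨(t.1 : ZMod p) * s₀, t.2⟩) ⟨?_, ?_⟩)
    · intro a b hab
      simp only [Subtype.mk.injEq] at hab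
      exact Subtype.ext (Units.ext (mul_right_cancel₀ hs₀0 hab))
    · rintro ⟨x, hx⟩
      have hx0 : x ≠ 0 := fun h => h0 (h ▸ hx)
      have hu : x / s₀ * s₀ = x := div_mul_cancel₀ x hs₀0
      refine ⟨⟨Units.mk0 (x / s₀) (div_ne_zero hx0 hs₀0), ?_⟩, ?_⟩
      · change x / s₀ * s₀ ∈ S
        rw [hu]; exact hx
      · exact Subtype.ext hu
  have := Subgroup.card_subgroup_dvd_card H
  rwa [hcard, Nat.card_eq_fintype_card, ZMod.card_units] at this

theorem card_inter_translate_of_half {p : ℕ} [Fact p.Prime] {S : Finset (ZMod p)}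
    (hmul : ∀ t s : ZMod p, t ≠ 0 → s ∈ S → t * s ∈ S → S.image (fun x => t * x) = S)
    (h0 : 0 ∉ S) (hneg : ∀ x ∈ S, -x ∈ S) (hcard : 2 * S.card = p - 1)
    {d : ZMod p} (hd : d ∈ S) :
    2 * (S.filter fun x => x - d ∈ S).card + 2 = S.card := by
  classical
  have hne : ∀ {x}, x ∈ S → x ≠ 0 := fun hx h => h0 (h ▸ hx)
  have hmem : ∀ {t s : ZMod p}, s ∈ S → t * s ∈ S → ∀ {x}, x ∈ S → t * x ∈ S := by
    intro t s hs hts x hx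
    have ht : t ≠ 0 := left_ne_zero_of_mul (hne hts)
    rw [← hmul t s ht hs hts]
    exact Finset.mem_image_of_mem _ hx
  have hmem' : ∀ {t s : ZMod p}, s ∈ S → t * s ∈ S → ∀ {x}, t * x ∈ S → x ∈ S := by
    intro t s hs hts x hx
    have ht : t ≠ 0 := left_ne_zero_of_mul (hne hts)
    rw [← hmul t s ht hs hts, Finset.mem_image] at hx
    obtain ⟨y, hy, hyx⟩ := hx
    rwa [← mul_left_cancel₀ ht hyx]
  set N : Finset (ZMod p) := Finset.univ.filter fun x => x ≠ 0 ∧ x ∉ S with hN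
  have hNmem : ∀ x, x ∈ N ↔ x ≠ 0 ∧ x ∉ S := by simp [hN]
  have hp : 2 ≤ p := (Fact.out : p.Prime).two_le
  have hNcard : N.card = S.card := by
    have h1 : N = (insert 0 S)ᶜ := by ext x; simp [hNmem]
    rw [h1, Finset.card_compl, Finset.card_insert_of_notMem h0, ZMod.card]
    omega
  have hSpos : 0 < S.card := Finset.card_pos.2 ⟨d, hd⟩
  obtain ⟨b₀, hb₀⟩ : N.Nonempty := Finset.card_pos.1 (hNcard ▸ hSpos)
  obtain ⟨n, hn⟩ : ∃ n, n = b₀ / d := ⟨_, rfl⟩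
  have hnd : n * d = b₀ := by rw [hn]; exact div_mul_cancel₀ _ (hne hd)
  have hn0 : n ≠ 0 := by
    rintro rfl
    exact ((hNmem _).1 hb₀).1 (by rw [← hnd, zero_mul])
  have hnS : ∀ x ∈ S, n * x ∈ N := by
    intro x hx
    rw [hNmem]
    refine ⟨mul_ne_zero hn0 (hne hx), fun h => ((hNmem _).1 hb₀).2 ?_⟩
    rw [← hnd]
    exact hmem hx h hd
  have hnSN : S.image (fun x => n * x) = N := by
    apply Finset.eq_of_subset_of_card_le
    · intro y hy
      obtain ⟨x, hx, rfl⟩ := Finset.mem_image.1 hy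
      exact hnS x hx
    · rw [Finset.card_image_of_injective _ (mul_right_injective₀ hn0), hNcard]
  have hnN : ∀ x ∈ N, n * x ∈ S := by
    intro x hx
    by_contra h
    have h1 : n * x ∈ N := (hNmem _).2 ⟨mul_ne_zero hn0 ((hNmem _).1 hx).1, h⟩
    rw [← hnSN, Finset.mem_image] at h1
    obtain ⟨y, hy, hyx⟩ := h1
    exact ((hNmem _).1 hx).2 (mul_left_cancel₀ hn0 hyx ▸ hy)
  have hnN' : ∀ x, n * x ∈ S → x ∈ N := by
    intro x hx
    rw [hNmem]
    refine ⟨right_ne_zero_of_mul (hne hx), fun h => ((hNmem _).1 (hnS x h)).2 hx⟩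
  have hNneg : ∀ x ∈ N, -x ∈ N := by
    intro x hx
    rw [hNmem] at hx ⊢
    exact ⟨neg_ne_zero.2 hx.1, fun h => hx.2 (by simpa using hneg _ h)⟩
  -- the number of neighbours of `a` outside `S ∪ {0}` does not depend on `a ∈ S`
  have hκ : ∀ a ∈ S, (N.filter fun b => b - a ∈ S).card = (N.filter fun b => b - d ∈ S).card := by
    intro a ha
    obtain ⟨t, ht⟩ : ∃ t, t = d / a := ⟨_, rfl⟩
    have hta : t * a = d := by rw [ht]; exact div_mul_cancel₀ _ (hne ha)
    have htS : t * a ∈ S := hta ▸ hd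
    have ht0 : t ≠ 0 := left_ne_zero_of_mul (hne htS)
    refine Finset.card_bij (fun b _ => t * b) ?_ (fun _ _ _ _ h => mul_left_cancel₀ ht0 h) ?_
    · intro b hb
      simp only [Finset.mem_filter, hNmem] at hb ⊢
      refine ⟨⟨mul_ne_zero ht0 hb.1.1, fun h => hb.1.2 (hmem' ha htS h)⟩, ?_⟩
      rw [← hta, ← mul_sub]
      exact hmem ha htS hb.2
    · intro b hb
      simp only [Finset.mem_filter, hNmem] at hb
      have htb : t * (t⁻¹ * b) = b := mul_inv_cancel_left₀ ht0 b
      refine ⟨t⁻¹ * b, ?_, htb⟩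
      simp only [Finset.mem_filter, hNmem]
      refine ⟨⟨mul_ne_zero (inv_ne_zero ht0) hb.1.1, fun h => hb.1.2 ?_⟩, ?_⟩
      · rw [← htb]; exact hmem ha htS h
      · apply hmem' ha htS
        rw [mul_sub, htb, hta]; exact hb.2
  have hswap : ∑ a ∈ S, (N.filter fun b => b - a ∈ S).card =
      ∑ a ∈ S, (N.filter fun b => ¬ b - a ∈ S).card := by
    rw [← Finset.card_sigma, ← Finset.card_sigma]
    refine Finset.card_bij (fun x _ => ⟨n * x.2, n * x.1⟩) ?_ ?_ ?_
    · rintro ⟨a, b⟩ hab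
      simp only [Finset.mem_sigma, Finset.mem_filter] at hab ⊢
      refine ⟨hnN _ hab.2.1, hnS _ hab.1, ?_⟩
      have := hNneg _ (hnS _ hab.2.2)
      rw [hNmem] at this
      rw [← mul_sub]
      rw [← mul_neg, neg_sub] at this
      exact this.2
    · rintro ⟨a, b⟩ _ ⟨a', b'⟩ _ h
      simp only [Sigma.mk.injEq, heq_eq_eq] at h ⊢
      exact ⟨mul_left_cancel₀ hn0 h.2, mul_left_cancel₀ hn0 h.1⟩
    · rintro ⟨a, b⟩ hab
      simp only [Finset.mem_sigma, Finset.mem_filter] at hab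
      have ha : n * (n⁻¹ * a) = a := mul_inv_cancel_left₀ hn0 a
      have hb : n * (n⁻¹ * b) = b := mul_inv_cancel_left₀ hn0 b
      have hbS : n⁻¹ * b ∈ S := by
        obtain ⟨y, hy, hyb⟩ := Finset.mem_image.1 (hnSN ▸ hab.2.1)
        rw [← hyb]
        simpa [hn0] using hy
      refine ⟨⟨n⁻¹ * b, n⁻¹ * a⟩, ?_, by simp [ha, hb]⟩
      simp only [Finset.mem_sigma, Finset.mem_filter]
      refine ⟨hbS, hnN' _ (by rw [ha]; exact hab.1), ?_⟩
      have hba : b - a ∈ N := (hNmem _).2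
        ⟨fun h => ((hNmem _).1 hab.2.1).2 (sub_eq_zero.1 h ▸ hab.1), hab.2.2⟩
      obtain ⟨y, hy, hyb⟩ := Finset.mem_image.1 (hnSN ▸ hba)
      have : n⁻¹ * a - n⁻¹ * b = -y := by
        apply mul_left_cancel₀ hn0
        rw [mul_sub, ha, hb, mul_neg, hyb, neg_sub]
      rw [this]
      exact hneg _ hy
  have hsplit : ∀ a, (N.filter fun b => b - a ∈ S).card + (N.filter fun b => ¬ b - a ∈ S).card
      = S.card := fun a => by rw [Finset.card_filter_add_card_filter_not, hNcard]
  have htot : ∑ a ∈ S, ((N.filter fun b => b - a ∈ S).card +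
      (N.filter fun b => ¬ b - a ∈ S).card) = S.card * S.card := by
    rw [Finset.sum_congr rfl fun a _ => hsplit a]; simp
  rw [Finset.sum_add_distrib, ← hswap, Finset.sum_congr rfl hκ, Finset.sum_const, smul_eq_mul,
    ← mul_add] at htot
  have hκ2 := Nat.eq_of_mul_eq_mul_left hSpos htot
  have hpart : (S.filter fun x => x - d ∈ S).card + 1 + (N.filter fun b => b - d ∈ S).card
      = S.card := by
    have h1 : S.image (fun x => x + d) = insert 0 (S.filter fun x => x - d ∈ S) ∪
        (N.filter fun b => b - d ∈ S) := by
      ext x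
      have hx : x ∈ S.image (fun x => x + d) ↔ x - d ∈ S := by
        rw [Finset.mem_image]
        exact ⟨by rintro ⟨y, hy, rfl⟩; simpa using hy, fun h => ⟨_, h, by simp⟩⟩
      rw [hx]
      simp only [Finset.mem_union, Finset.mem_insert, Finset.mem_filter, hNmem]
      by_cases hx0 : x = 0
      · subst hx0; simpa using hneg d hd
      · by_cases hxS : x ∈ S <;> simp [hx0, hxS]
    have h2 : Disjoint (insert 0 (S.filter fun x => x - d ∈ S))
        (N.filter fun b => b - d ∈ S) := by
      rw [Finset.disjoint_left]
      intro x hx hx'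
      simp only [Finset.mem_insert, Finset.mem_filter, hNmem] at hx hx'
      rcases hx with hx | hx
      · exact hx'.1.1 hx
      · exact hx'.1.2 hx.1
    have h3 := Finset.card_image_of_injective S (add_left_injective d)
    rw [h1, Finset.card_union_of_disjoint h2,
      Finset.card_insert_of_notMem (by simp [h0])] at h3
    exact h3
  omega

section PrimeOrder

variable {W : Type*} [Fintype W] {p : ℕ} [Fact p.Prime]

/-- A vertex transitive graph of prime order is a Cayley graph of `ZMod p`; the base vertex can
be prescribed. -/
theorem exists_circulant_labelling_s9 (Y : SimpleGraph W) (hW : Fintype.card W = p)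
    (hY : ∀ a b, ∃ φ : Y ≃g Y, φ a = b) (a₀ : W) :
    ∃ (e : W ≃ ZMod p) (S : Finset (ZMod p)), e a₀ = 0 ∧
      ∀ a b, Y.Adj a b ↔ e b - e a ∈ S := by
  classical
  have hp : p.Prime := Fact.out
  have : Finite (Y ≃g Y) := Finite.of_injective (fun φ : Y ≃g Y => (φ : W → W))
    DFunLike.coe_injective
  have hdvd : p ∣ Nat.card (Y ≃g Y) := by
    have : MulAction.IsPretransitive (Y ≃g Y) W := ⟨hY⟩
    have h := MulAction.index_stabilizer_of_transitive (Y ≃g Y) a₀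
    rw [Nat.card_eq_fintype_card, hW] at h
    rw [← h]
    exact Subgroup.index_dvd_card _
  obtain ⟨σ, hσ⟩ := exists_prime_orderOf_dvd_card' p hdvd
  set τ : Equiv.Perm W := MulAction.toPermHom (Y ≃g Y) W σ with hτ
  have hτpow : ∀ (n : ℕ) x, (τ ^ n) x = (σ ^ n) x := by
    intro n x
    rw [hτ, ← map_pow]
    rfl
  have hτord : orderOf τ = p := by
    rw [hτ, orderOf_injective _ MulAction.toPerm_injective, hσ]
  have hcyc : τ.IsCycle := Equiv.Perm.isCycle_of_prime_order'' (hW ▸ hp) (hτord.trans hW.symm)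
  have hsupp : τ.support = Finset.univ := by
    rw [← Finset.card_eq_iff_eq_univ, ← hcyc.orderOf, hτord, hW]
  have hmove : ∀ x, τ x ≠ x := fun x => Equiv.Perm.mem_support.1 (hsupp ▸ Finset.mem_univ x)
  have hmod : ∀ n : ℕ, τ ^ (n : ZMod p).val = τ ^ n := by
    intro n
    rw [ZMod.val_natCast, ← hτord, pow_mod_orderOf]
  set f : ZMod p → W := fun k => (τ ^ k.val) a₀ with hf
  have hsurj : Function.Surjective f := by
    intro x
    obtain ⟨n, hn⟩ := (hcyc.sameCycle (hmove a₀) (hmove x)).exists_nat_pow_eq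
    exact ⟨(n : ZMod p), by rw [hf]; simp only [hmod, hn]⟩
  have hbij : Function.Bijective f :=
    (Fintype.bijective_iff_surjective_and_card f).2 ⟨hsurj, by rw [ZMod.card, hW]⟩
  have hadd : ∀ i k, f (i + k) = (σ ^ i.val) (f k) := by
    intro i k
    rw [hf]
    simp only [← hτpow, ← Equiv.Perm.mul_apply, ← pow_add]
    rw [← hmod (i.val + k.val)]
    simp
  have hf0 : f 0 = a₀ := by simp [hf]
  refine ⟨(Equiv.ofBijective f hbij).symm, Finset.univ.filter fun k => Y.Adj a₀ (f k), ?_, ?_⟩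
  · rw [Equiv.symm_apply_eq]
    exact hf0.symm
  · intro a b
    obtain ⟨i, rfl⟩ := hsurj a
    obtain ⟨j, rfl⟩ := hsurj b
    have hs : ∀ k, (Equiv.ofBijective f hbij).symm (f k) = k := fun k =>
      (Equiv.ofBijective f hbij).symm_apply_apply k
    simp only [hs, Finset.mem_filter, Finset.mem_univ, true_and]
    have h1 : f j = (σ ^ i.val) (f (j - i)) := by rw [← hadd, add_sub_cancel]
    have h2 : f i = (σ ^ i.val) a₀ := by rw [← hf0, ← hadd, add_zero]
    rw [h1, h2, SimpleGraph.Iso.map_adj_iff]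

theorem exists_adj_ne_of_prime_order (Y : SimpleGraph W) (hW : Fintype.card W = p)
    (hY : ∀ a b, ∃ φ : Y ≃g Y, φ a = b) (hne : Y ≠ ⊥) {a b : W} (hab : a ≠ b) :
    ∃ x, ¬(Y.Adj a x ↔ Y.Adj b x) := by
  obtain ⟨e, S, -, he⟩ := exists_circulant_labelling_s9 Y hW hY a
  by_contra! hcon
  obtain ⟨c, d, hcd⟩ := SimpleGraph.ne_bot_iff_exists_adj.1 hne
  set δ := e a - e b with hδ
  have hδ0 : δ ≠ 0 := sub_ne_zero.2 (e.injective.ne hab)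
  have hstep : ∀ s, s ∈ S → s + δ ∈ S := by
    intro s hs
    have := hcon (e.symm (s + e a))
    rw [he, he] at this
    simp only [Equiv.apply_symm_apply, add_sub_cancel_right] at this
    have := this.1 hs
    rwa [add_sub_assoc] at this
  have hiter : ∀ (k : ℕ) s, s ∈ S → s + k * δ ∈ S := by
    intro k
    induction k with
    | zero => simp
    | succ k ih =>
      intro s hs
      have := hstep _ (ih s hs)
      rwa [add_assoc, ← add_one_mul, ← Nat.cast_succ] at this
  have h := hiter (-(e d - e c) / δ).val _ ((he c d).1 hcd)
  rw [ZMod.natCast_val, ZMod.cast_id', id, div_mul_cancel₀ _ hδ0, add_neg_cancel] at h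
  exact Y.irrefl ((he a a).2 (by rwa [sub_self]))

theorem degree_dvd_and_card_common_of_prime_order (Y : SimpleGraph W) [DecidableRel Y.Adj]
    (hW : Fintype.card W = p)
    (hY : ∀ a b, ∃ φ : Y ≃g Y, φ a = b)
    (hY2 : ∀ a b c d, Y.Adj a b → Y.Adj c d → ∃ φ : Y ≃g Y, φ a = c ∧ φ b = d)
    {a b : W} (hab : Y.Adj a b) :
    Y.degree a ∣ p - 1 ∧ (2 * Y.degree a = p - 1 →
      2 * (Finset.univ.filter fun x => Y.Adj a x ∧ Y.Adj b x).card + 2 = Y.degree a) := by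
  classical
  obtain ⟨e, S, hea, he⟩ := exists_circulant_labelling_s9 Y hW hY a
  have h0 : 0 ∉ S := fun h => Y.irrefl ((he a a).2 (by rwa [sub_self]))
  have hadj : ∀ x, Y.Adj a x ↔ e x ∈ S := fun x => by rw [he, hea, sub_zero]
  have hneg : ∀ x ∈ S, -x ∈ S := by
    intro x hx
    have h1 : Y.Adj a (e.symm x) := by rw [hadj]; simpa using hx
    have h2 := (he _ _).1 h1.symm
    simpa [hea] using h2
  have hdeg : Y.degree a = S.card := by
    rw [← SimpleGraph.card_neighborFinset_eq_degree]
    refine Finset.card_equiv e fun x => ?_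
    rw [SimpleGraph.mem_neighborFinset, hadj]
  have htr : ∀ s ∈ S, ∀ s' ∈ S, ∃ φ : Equiv.Perm (ZMod p),
      (∀ x y, φ y - φ x ∈ S ↔ y - x ∈ S) ∧ φ 0 = 0 ∧ φ s = s' := by
    intro s hs s' hs'
    obtain ⟨φ, h1, h2⟩ := hY2 a (e.symm s) a (e.symm s') ((hadj _).2 (by simpa using hs))
      ((hadj _).2 (by simpa using hs'))
    refine ⟨(e.symm.trans φ.toEquiv).trans e, ?_, ?_, ?_⟩
    · intro x y
      have := φ.map_adj_iff (v := e.symm x) (w := e.symm y)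
      rw [he, he] at this
      simpa using this
    · have : e.symm 0 = a := by rw [← hea, Equiv.symm_apply_apply]
      simp [this, h1, hea]
    · simp [h2]
  have hmul : ∀ t s : ZMod p, t ≠ 0 → s ∈ S → t * s ∈ S → S.image (fun x => t * x) = S :=
    fun t s ht hs hts => image_mul_eq_of_orbit htr ht hs hts
  have hbS : e b ∈ S := (hadj b).1 hab
  rw [hdeg]
  refine ⟨card_dvd_of_image_mul_eq hmul h0 ⟨_, hbS⟩, fun hhalf => ?_⟩
  rw [← card_inter_translate_of_half hmul h0 hneg hhalf hbS]
  congr 2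
  refine Finset.card_equiv e fun x => ?_
  simp [hadj, he b x]

end PrimeOrder

theorem even_card_mul_of_regular {W : Type*} [Fintype W] (Y : SimpleGraph W) [DecidableRel Y.Adj]
    {k : ℕ} (h : ∀ a, Y.degree a = k) : Even (Fintype.card W * k) := by
  have := Y.sum_degrees_eq_twice_card_edges
  rw [Finset.sum_congr rfl fun a _ => h a, Finset.sum_const, smul_eq_mul, Finset.card_univ] at this
  exact this ▸ even_two_mul _

theorem dist_eq_two_iff_exists {V : Type*} (Γ : SimpleGraph V) (v x : V) :
    Γ.dist v x = 2 ↔ v ≠ x ∧ ¬ Γ.Adj v x ∧ ∃ y, Γ.Adj v y ∧ Γ.Adj y x := by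
  have h : Γ.dist v x = 2 ↔ Γ.edist v x = 2 := by
    rw [SimpleGraph.dist, ENat.toNat_eq_iff (by norm_num)]
    rfl
  rw [h, SimpleGraph.edist_eq_two_iff]
  simp only [Set.Nonempty, SimpleGraph.mem_commonNeighbors, Γ.adj_comm x]

theorem card_filter_eq_of_perm {V : Type*} [Fintype V] {P Q : V → Prop} [DecidablePred P]
    [DecidablePred Q] (φ : V ≃ V) (h : ∀ x, P x ↔ Q (φ x)) :
    (Finset.univ.filter P).card = (Finset.univ.filter Q).card :=
  Finset.card_equiv φ fun x => by simp [h x]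

/-- An automorphism fixing `u` acts on the graph induced on the neighbours of `u`. -/
def linkIso {V : Type*} {Γ : SimpleGraph V} {u : V} (φ : Γ ≃g Γ) (h : φ u = u) :
    Γ.induce (Γ.neighborSet u) ≃g Γ.induce (Γ.neighborSet u) where
  toEquiv := φ.toEquiv.subtypeEquiv fun a => by
    have := φ.map_adj_iff (v := u) (w := a)
    rw [h] at this
    exact this.symm
  map_rel_iff' := φ.map_adj_iff

/-- The action of a graph automorphism on the complement. -/
def complIso {W : Type*} {X : SimpleGraph W} (φ : X ≃g X) : Xᶜ ≃g Xᶜ where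
  toEquiv := φ.toEquiv
  map_rel_iff' := by
    intro a b
    have h := φ.map_adj_iff (v := a) (w := b)
    simp only [SimpleGraph.compl_adj, ne_eq, φ.toEquiv.injective.eq_iff]
    exact and_congr_right fun _ => not_congr h

section Local

open Classical

variable {V : Type*} {Γ : SimpleGraph V}

theorem link_transitive (h : TwoGeodesicTransitive Γ) (u : V) (a b : Γ.neighborSet u) :
    ∃ φ : Γ.induce (Γ.neighborSet u) ≃g Γ.induce (Γ.neighborSet u), φ a = b := by
  obtain ⟨φ, h1, h2⟩ := h.1 a.2 b.2
  exact ⟨linkIso φ h1, Subtype.ext h2⟩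

theorem compl_link_transitive (h : TwoGeodesicTransitive Γ) (u : V) (a b : Γ.neighborSet u) :
    ∃ φ : (Γ.induce (Γ.neighborSet u))ᶜ ≃g (Γ.induce (Γ.neighborSet u))ᶜ, φ a = b := by
  obtain ⟨φ, hφ⟩ := link_transitive h u a b
  exact ⟨complIso φ, hφ⟩

theorem compl_link_arc_transitive (h : TwoGeodesicTransitive Γ) (u : V)
    (a b c d : Γ.neighborSet u) (hab : (Γ.induce (Γ.neighborSet u))ᶜ.Adj a b)
    (hcd : (Γ.induce (Γ.neighborSet u))ᶜ.Adj c d) :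
    ∃ φ : (Γ.induce (Γ.neighborSet u))ᶜ ≃g (Γ.induce (Γ.neighborSet u))ᶜ,
      φ a = c ∧ φ b = d := by
  rw [SimpleGraph.compl_adj] at hab hcd
  obtain ⟨φ, h1, h2, h3⟩ := h.2
    (⟨a.2.symm, b.2, fun h => hab.1 (Subtype.ext h), hab.2⟩ : Is2Geodesic Γ a u b)
    (⟨c.2.symm, d.2, fun h => hcd.1 (Subtype.ext h), hcd.2⟩ : Is2Geodesic Γ c u d)
  exact ⟨complIso (linkIso φ h2), Subtype.ext h1, Subtype.ext h3⟩

variable [Fintype V] {p : ℕ}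

theorem card_filter_link (u : V) (P : V → Prop) [DecidablePred P]
    [DecidablePred fun x => Γ.Adj u x ∧ P x] :
    (Finset.univ.filter fun x : Γ.neighborSet u => P x).card =
      (Finset.univ.filter fun x => Γ.Adj u x ∧ P x).card := by
  rw [← Finset.card_map (Function.Embedding.subtype _)]
  congr 1
  ext x
  simp [and_comm]

theorem degree_compl_link (u : V) (a : Γ.neighborSet u) :
    (Γ.induce (Γ.neighborSet u))ᶜ.degree a =
      (Finset.univ.filter fun x => Γ.Adj u x ∧ a ≠ x ∧ ¬ Γ.Adj a x).card := by
  rw [← card_filter_link u fun x => (a : V) ≠ x ∧ ¬ Γ.Adj a x, ← SimpleGraph.card_neighborFinset_eq_degree]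
  congr 1
  ext x
  simp [SimpleGraph.compl_adj, Subtype.ext_iff]

theorem card_link (hreg : ∀ v : V, Nat.card (Γ.neighborSet v) = p) (u : V) :
    Fintype.card (Γ.neighborSet u) = p := by
  rw [← Nat.card_eq_fintype_card, hreg]

theorem even_mul_of_link (hreg : ∀ v : V, Nat.card (Γ.neighborSet v) = p) (u : V) {m : ℕ}
    (hm : ∀ v, Γ.Adj u v →
      (Finset.univ.filter fun x => Γ.Adj u x ∧ v ≠ x ∧ ¬ Γ.Adj v x).card = m) :
    Even (p * m) := by
  have := even_card_mul_of_regular (Γ.induce (Γ.neighborSet u))ᶜ (k := m)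
    fun a => by rw [degree_compl_link, hm a a.2]
  rwa [card_link hreg] at this

variable [Fact p.Prime]

theorem degree_dvd_and_card_common_of_geodesic (h : TwoGeodesicTransitive Γ)
    (hreg : ∀ v : V, Nat.card (Γ.neighborSet v) = p) {v u w : V} (hg : Is2Geodesic Γ v u w)
    {m : ℕ} (hm : (Finset.univ.filter fun x => Γ.Adj u x ∧ v ≠ x ∧ ¬ Γ.Adj v x).card = m) :
    m ∣ p - 1 ∧ (2 * m = p - 1 →
      2 * (Finset.univ.filter fun x => Γ.Adj u x ∧ (v ≠ x ∧ ¬ Γ.Adj v x) ∧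
        (w ≠ x ∧ ¬ Γ.Adj w x)).card + 2 = m) := by
  have hadj : (Γ.induce (Γ.neighborSet u))ᶜ.Adj ⟨v, hg.1.symm⟩ ⟨w, hg.2.1⟩ := by
    rw [SimpleGraph.compl_adj]
    exact ⟨fun h => hg.2.2.1 (congrArg Subtype.val h), hg.2.2.2⟩
  have := degree_dvd_and_card_common_of_prime_order _ (card_link hreg u)
    (compl_link_transitive h u) (compl_link_arc_transitive h u) hadj
  rw [degree_compl_link, hm] at this
  refine ⟨this.1, fun h2 => ?_⟩
  rw [← this.2 h2, ← card_filter_link u fun x => (v ≠ x ∧ ¬ Γ.Adj v x) ∧ (w ≠ x ∧ ¬ Γ.Adj w x)]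
  congr 3
  ext x
  simp [SimpleGraph.compl_adj, Subtype.ext_iff]

theorem exists_link_adj_ne (h : TwoGeodesicTransitive Γ)
    (hreg : ∀ v : V, Nat.card (Γ.neighborSet v) = p) {u a b y z : V}
    (ha : Γ.Adj u a) (hb : Γ.Adj u b) (hab : a ≠ b)
    (hy : Γ.Adj u y) (hz : Γ.Adj u z) (hyz : Γ.Adj y z) :
    ∃ x, Γ.Adj u x ∧ ¬ (Γ.Adj a x ↔ Γ.Adj b x) := by
  obtain ⟨x, hx⟩ := exists_adj_ne_of_prime_order (Γ.induce (Γ.neighborSet u)) (card_link hreg u)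
    (link_transitive h u) (SimpleGraph.ne_bot_iff_exists_adj.2 ⟨⟨y, hy⟩, ⟨z, hz⟩, hyz⟩)
    (a := ⟨a, ha⟩) (b := ⟨b, hb⟩) (fun h => hab (congrArg Subtype.val h))
  exact ⟨x, x.2, hx⟩

theorem exists_link_nonadj_ne (h : TwoGeodesicTransitive Γ)
    (hreg : ∀ v : V, Nat.card (Γ.neighborSet v) = p) {u a b y z : V}
    (ha : Γ.Adj u a) (hb : Γ.Adj u b) (hab : a ≠ b)
    (hy : Γ.Adj u y) (hz : Γ.Adj u z) (hyz : y ≠ z) (hyz' : ¬ Γ.Adj y z) :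
    ∃ x, Γ.Adj u x ∧ ¬ ((a ≠ x ∧ ¬ Γ.Adj a x) ↔ (b ≠ x ∧ ¬ Γ.Adj b x)) := by
  obtain ⟨x, hx⟩ := exists_adj_ne_of_prime_order (Γ.induce (Γ.neighborSet u))ᶜ (card_link hreg u)
    (compl_link_transitive h u) (SimpleGraph.ne_bot_iff_exists_adj.2 ⟨⟨y, hy⟩, ⟨z, hz⟩, by
      rw [SimpleGraph.compl_adj]
      exact ⟨fun h => hyz (congrArg Subtype.val h), hyz'⟩⟩)
    (a := ⟨a, ha⟩) (b := ⟨b, hb⟩) (fun h => hab (congrArg Subtype.val h))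
  refine ⟨x, x.2, ?_⟩
  simpa only [SimpleGraph.compl_adj, Subtype.ext_iff, SimpleGraph.comap_adj, ne_eq,
    Function.Embedding.subtype_apply] using hx

end Local

section Global

open Classical

variable {V : Type*} {Γ : SimpleGraph V}

theorem exists_triangle_of_not_twoArcTransitive_s9 (h : TwoGeodesicTransitive Γ)
    (h2 : ¬ TwoArcTransitive Γ) : ∃ x y z, Γ.Adj x y ∧ Γ.Adj y z ∧ Γ.Adj x z := by
  by_contra! hcon
  refine h2 ⟨h.1, fun v u w v' u' w' ha hb => h.2 ?_ ?_⟩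
  · exact ⟨ha.1, ha.2.1, ha.2.2, hcon _ _ _ ha.1 ha.2.1⟩
  · exact ⟨hb.1, hb.2.1, hb.2.2, hcon _ _ _ hb.1 hb.2.1⟩

theorem dist_eq_two_iso (φ : Γ ≃g Γ) (v x : V) :
    Γ.dist (φ v) (φ x) = 2 ↔ Γ.dist v x = 2 := by
  rw [dist_eq_two_iff_exists, dist_eq_two_iff_exists, φ.map_adj_iff, φ.injective.ne_iff,
    φ.surjective.exists]
  simp only [φ.map_adj_iff]

theorem exists_geodesic_of_dist_eq_two {v x : V} (h : Γ.dist v x = 2) :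
    ∃ y, Is2Geodesic Γ v y x := by
  obtain ⟨h1, h2, y, h3, h4⟩ := (dist_eq_two_iff_exists Γ v x).1 h
  exact ⟨y, h3, h4, h1, h2⟩

variable [Fintype V] {p : ℕ}

theorem card_nonadj_eq_of_arcTransitive (h : ArcTransitive Γ) {v u v' u' : V}
    (h1 : Γ.Adj v u) (h2 : Γ.Adj v' u') :
    (Finset.univ.filter fun x => Γ.Adj u x ∧ v ≠ x ∧ ¬ Γ.Adj v x).card =
      (Finset.univ.filter fun x => Γ.Adj u' x ∧ v' ≠ x ∧ ¬ Γ.Adj v' x).card := by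
  obtain ⟨φ, rfl, rfl⟩ := h h1 h2
  refine card_filter_eq_of_perm φ.toEquiv fun x => ?_
  change _ ↔ Γ.Adj (φ u) (φ x) ∧ φ v ≠ φ x ∧ ¬ Γ.Adj (φ v) (φ x)
  rw [φ.map_adj_iff, φ.map_adj_iff, φ.injective.ne_iff]

theorem card_common_eq_of_geodesic (h : TwoGeodesicTransitive Γ) {v u w v' u' w' : V}
    (h1 : Is2Geodesic Γ v u w) (h2 : Is2Geodesic Γ v' u' w') :
    (Finset.univ.filter fun x => Γ.Adj v x ∧ Γ.Adj w x).card =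
      (Finset.univ.filter fun x => Γ.Adj v' x ∧ Γ.Adj w' x).card := by
  obtain ⟨φ, rfl, rfl, rfl⟩ := h.2 h1 h2
  refine card_filter_eq_of_perm φ.toEquiv fun x => ?_
  change _ ↔ Γ.Adj (φ v) (φ x) ∧ Γ.Adj (φ w) (φ x)
  rw [φ.map_adj_iff, φ.map_adj_iff]

theorem card_dist_two_eq_of_geodesic (h : TwoGeodesicTransitive Γ) {v u w v' u' w' : V}
    (h1 : Is2Geodesic Γ v u w) (h2 : Is2Geodesic Γ v' u' w') :
    (Finset.univ.filter fun x => Γ.Adj w x ∧ Γ.dist v x = 2).card =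
      (Finset.univ.filter fun x => Γ.Adj w' x ∧ Γ.dist v' x = 2).card := by
  obtain ⟨φ, rfl, rfl, rfl⟩ := h.2 h1 h2
  refine card_filter_eq_of_perm φ.toEquiv fun x => ?_
  change _ ↔ Γ.Adj (φ w) (φ x) ∧ Γ.dist (φ v) (φ x) = 2
  rw [φ.map_adj_iff, dist_eq_two_iso]

theorem card_filter_adj (hreg : ∀ v : V, Nat.card (Γ.neighborSet v) = p) (u : V) :
    (Finset.univ.filter fun x => Γ.Adj u x).card = p := by
  rw [← hreg u, Nat.card_eq_fintype_card, SimpleGraph.card_neighborSet_eq_degree,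
    ← SimpleGraph.card_neighborFinset_eq_degree]
  congr 1
  ext x
  simp

/-- Counting the edges between the neighbours of `v` and the vertices at distance two. -/
theorem card_mul_card_nonadj (h : TwoGeodesicTransitive Γ)
    (hreg : ∀ v : V, Nat.card (Γ.neighborSet v) = p) {v u w : V} (hg : Is2Geodesic Γ v u w) :
    p * (Finset.univ.filter fun x => Γ.Adj u x ∧ v ≠ x ∧ ¬ Γ.Adj v x).card =
      (Finset.univ.filter fun x => Γ.dist v x = 2).card *
        (Finset.univ.filter fun x => Γ.Adj v x ∧ Γ.Adj w x).card := by
  rw [← card_filter_adj hreg v]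
  apply Finset.card_mul_eq_card_mul Γ.Adj
  · intro a ha
    simp only [Finset.mem_filter, Finset.mem_univ, true_and] at ha
    rw [card_nonadj_eq_of_arcTransitive h.1 hg.1 ha, Finset.bipartiteAbove, Finset.filter_filter]
    congr 1
    ext x
    simp only [Finset.mem_filter, Finset.mem_univ, true_and, dist_eq_two_iff_exists]
    exact ⟨fun hx => ⟨hx.2, hx.1.1, hx.1.2.1⟩, fun hx => ⟨⟨hx.2.1, hx.2.2, a, ha, hx.1⟩, hx.1⟩⟩
  · intro b hb
    simp only [Finset.mem_filter, Finset.mem_univ, true_and] at hb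
    obtain ⟨y, hy⟩ := exists_geodesic_of_dist_eq_two hb
    rw [card_common_eq_of_geodesic h hg hy, Finset.bipartiteBelow, Finset.filter_filter]
    congr 1
    ext x
    simp only [Finset.mem_filter, Finset.mem_univ, true_and, Γ.adj_comm b]

theorem even_card_mul_card_dist_two (h : TwoGeodesicTransitive Γ) {v u w : V}
    (hg : Is2Geodesic Γ v u w) :
    Even ((Finset.univ.filter fun x => Γ.dist v x = 2).card *
      (Finset.univ.filter fun x => Γ.Adj w x ∧ Γ.dist v x = 2).card) := by
  have := even_card_mul_of_regular (Γ.induce {x | Γ.dist v x = 2})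
    (k := (Finset.univ.filter fun x => Γ.Adj w x ∧ Γ.dist v x = 2).card) ?_
  · rwa [Fintype.card_subtype] at this
  · rintro ⟨a, ha⟩
    obtain ⟨y, hy⟩ := exists_geodesic_of_dist_eq_two ha
    rw [card_dist_two_eq_of_geodesic h hg hy, ← SimpleGraph.card_neighborFinset_eq_degree,
      ← Finset.card_map (Function.Embedding.subtype _)]
    congr 1
    ext x
    simp [and_comm]

theorem card_common_lower_bound (hreg : ∀ v : V, Nat.card (Γ.neighborSet v) = p)
    (h : TwoGeodesicTransitive Γ) {v u w : V} (hg : Is2Geodesic Γ v u w) {m : ℕ}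
    (hm : (Finset.univ.filter fun x => Γ.Adj u x ∧ v ≠ x ∧ ¬ Γ.Adj v x).card = m) :
    p + 1 + (Finset.univ.filter fun x => Γ.Adj u x ∧ (v ≠ x ∧ ¬ Γ.Adj v x) ∧
        (w ≠ x ∧ ¬ Γ.Adj w x)).card ≤
      (Finset.univ.filter fun x => Γ.Adj v x ∧ Γ.Adj w x).card + 2 * m := by
  set A := Finset.univ.filter fun x => Γ.Adj u x ∧ v ≠ x ∧ ¬ Γ.Adj v x with hA
  set B := Finset.univ.filter fun x => Γ.Adj u x ∧ w ≠ x ∧ ¬ Γ.Adj w x with hB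
  set C := Finset.univ.filter fun x => Γ.Adj v x ∧ Γ.Adj w x with hC
  have hBm : B.card = m := by
    rw [← hm, hB]
    exact card_nonadj_eq_of_arcTransitive h.1 hg.2.1.symm hg.1
  have hI : (Finset.univ.filter fun x => Γ.Adj u x ∧ (v ≠ x ∧ ¬ Γ.Adj v x) ∧
        (w ≠ x ∧ ¬ Γ.Adj w x)) = A ∩ B := by
    ext x; simp only [hA, hB, Finset.mem_filter, Finset.mem_univ, true_and, Finset.mem_inter]
    tauto
  have huC : u ∈ C := by simp [hC, hg.1, hg.2.1.symm]
  have hsub : (Finset.univ.filter fun x => Γ.Adj u x) ⊆ (A ∪ B) ∪ C.erase u := by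
    intro x hx
    simp only [hA, hB, hC, Finset.mem_filter, Finset.mem_univ, true_and, Finset.mem_union,
      Finset.mem_erase] at hx ⊢
    by_cases hv : v = x
    · subst hv
      exact Or.inl (Or.inr ⟨hx, hg.2.2.1.symm, fun h => hg.2.2.2 h.symm⟩)
    by_cases hw : w = x
    · subst hw
      exact Or.inl (Or.inl ⟨hx, hg.2.2.1, hg.2.2.2⟩)
    have := hx.ne'
    tauto
  have h1 := Finset.card_le_card hsub
  rw [card_filter_adj hreg] at h1
  have h2 := Finset.card_union_le (A ∪ B) (C.erase u)
  have h3 := Finset.card_union_add_card_inter A B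
  have h4 := Finset.card_erase_add_one huC
  rw [hI]
  omega

variable [Fact p.Prime]

theorem card_common_lt (hreg : ∀ v : V, Nat.card (Γ.neighborSet v) = p)
    (h : TwoGeodesicTransitive Γ) {v u w z : V} (hg : Is2Geodesic Γ v u w)
    (hz : Γ.Adj u z) (hvz : Γ.Adj v z) :
    (Finset.univ.filter fun x => Γ.Adj v x ∧ Γ.Adj w x).card < p := by
  by_contra! hle
  have hv : (Finset.univ.filter fun x => Γ.Adj v x ∧ Γ.Adj w x) =
      Finset.univ.filter fun x => Γ.Adj v x :=
    Finset.eq_of_subset_of_card_le (fun x hx => by simp at hx ⊢; exact hx.1)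
      (by rwa [card_filter_adj hreg])
  have hw : (Finset.univ.filter fun x => Γ.Adj v x ∧ Γ.Adj w x) =
      Finset.univ.filter fun x => Γ.Adj w x :=
    Finset.eq_of_subset_of_card_le (fun x hx => by simp at hx ⊢; exact hx.2)
      (by rwa [card_filter_adj hreg])
  obtain ⟨x, -, hx⟩ := exists_link_adj_ne h hreg hg.1.symm hg.2.1 hg.2.2.1 hg.1.symm hz hvz
  have := Finset.ext_iff.1 (hv.symm.trans hw) x
  simp only [Finset.mem_filter, Finset.mem_univ, true_and] at this
  exact hx this

/-- If `v` and `w` have as many common neighbours as each neighbour of `w` has non-neighbours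
adjacent to `w`, then at most one neighbour of `w` is at distance greater than two from `v`. -/
theorem card_far_le_one (hreg : ∀ v : V, Nat.card (Γ.neighborSet v) = p)
    (h : TwoGeodesicTransitive Γ) {v u w : V} (hg : Is2Geodesic Γ v u w)
    (hc : (Finset.univ.filter fun x => Γ.Adj u x ∧ v ≠ x ∧ ¬ Γ.Adj v x).card =
      (Finset.univ.filter fun x => Γ.Adj v x ∧ Γ.Adj w x).card) :
    (Finset.univ.filter fun x => Γ.Adj w x ∧ ¬ Γ.Adj v x ∧ ¬ Γ.dist v x = 2).card ≤ 1 := by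
  have key : ∀ d, Γ.Adj w d → ¬ Γ.Adj v d → ¬ Γ.dist v d = 2 →
      (Finset.univ.filter fun x => Γ.Adj v x ∧ Γ.Adj w x) =
        Finset.univ.filter fun x => Γ.Adj w x ∧ d ≠ x ∧ ¬ Γ.Adj d x := by
    intro d hwd hvd hd
    apply Finset.eq_of_subset_of_card_le
    · intro x hx
      simp only [Finset.mem_filter, Finset.mem_univ, true_and] at hx ⊢
      refine ⟨hx.2, ?_, fun hdx => hd ?_⟩
      · rintro rfl
        exact hvd hx.1
      · rw [dist_eq_two_iff_exists]
        refine ⟨?_, hvd, x, hx.1, hdx.symm⟩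
        rintro rfl
        exact hg.2.2.2 hwd.symm
    · rw [← hc, card_nonadj_eq_of_arcTransitive h.1 hg.1 hwd.symm]
  rw [Finset.card_le_one]
  intro d hd d' hd'
  simp only [Finset.mem_filter, Finset.mem_univ, true_and] at hd hd'
  by_contra hne
  have hu : u ∈ Finset.univ.filter fun x => Γ.Adj v x ∧ Γ.Adj w x := by
    simp [hg.1, hg.2.1.symm]
  have h1 := key d hd.1 hd.2.1 hd.2.2
  have h2 := key d' hd'.1 hd'.2.1 hd'.2.2
  have hu' := h1 ▸ hu
  simp only [Finset.mem_filter, Finset.mem_univ, true_and] at hu'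
  obtain ⟨x, hwx, hx⟩ := exists_link_nonadj_ne h hreg hd.1 hd'.1 hne hd.1 hu'.1 hu'.2.1 hu'.2.2
  have := Finset.ext_iff.1 (h1.symm.trans h2) x
  simp only [Finset.mem_filter, Finset.mem_univ, true_and, hwx] at this
  exact hx this

theorem card_adj_dist_two (hreg : ∀ v : V, Nat.card (Γ.neighborSet v) = p)
    (h : TwoGeodesicTransitive Γ) (h2 : ¬ TwoArcTransitive Γ) {v u w : V}
    (hg : Is2Geodesic Γ v u w) :
    (Finset.univ.filter fun x => Γ.Adj w x ∧ Γ.dist v x = 2).card = (p - 1) / 2 := by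
  have hp : p.Prime := Fact.out
  obtain ⟨z, huz, hvz⟩ : ∃ z, Γ.Adj u z ∧ Γ.Adj v z := by
    obtain ⟨x, y, z, hxy, hyz, hxz⟩ := exists_triangle_of_not_twoArcTransitive_s9 h h2
    obtain ⟨φ, rfl, rfl⟩ := h.1 hxy hg.1
    exact ⟨φ z, φ.map_adj_iff.2 hyz, φ.map_adj_iff.2 hxz⟩
  obtain ⟨m, hm⟩ : ∃ m, (Finset.univ.filter fun x => Γ.Adj u x ∧ v ≠ x ∧ ¬ Γ.Adj v x).card = m :=
    ⟨_, rfl⟩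
  obtain ⟨hdvd, hhalf⟩ := degree_dvd_and_card_common_of_geodesic h hreg hg hm
  have hlow := card_common_lower_bound hreg h hg hm
  have hclt := card_common_lt hreg h hg huz hvz
  have hcount := card_mul_card_nonadj h hreg hg
  have hfar := card_far_le_one hreg h hg
  have heven := even_card_mul_card_dist_two h hg
  have hmeven := even_mul_of_link hreg u (m := m) fun a ha => by
    rw [← hm, card_nonadj_eq_of_arcTransitive h.1 ha.symm hg.1]
  rw [hm] at hcount hfar
  have hmpos : 0 < m := by
    rw [← hm, Finset.card_pos]
    exact ⟨w, by simp [hg.2.1, hg.2.2.1, hg.2.2.2]⟩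
  have hmlt : m + 2 ≤ p := by
    rw [← hm, ← card_filter_adj hreg u, ← Finset.card_pair hvz.ne, ← Finset.card_union_of_disjoint]
    · apply Finset.card_le_card
      intro x hx
      simp only [Finset.mem_union, Finset.mem_filter, Finset.mem_univ, true_and,
        Finset.mem_insert, Finset.mem_singleton] at hx ⊢
      rcases hx with hx | rfl | rfl
      exacts [hx.1, hg.1.symm, huz]
    · rw [Finset.disjoint_left]
      intro x hx hx'
      simp only [Finset.mem_filter, Finset.mem_univ, true_and,
        Finset.mem_insert, Finset.mem_singleton] at hx hx'
      rcases hx' with rfl | rfl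
      exacts [hx.2.1 rfl, hx.2.2 hvz]
  have hsum : (Finset.univ.filter fun x => Γ.Adj v x ∧ Γ.Adj w x).card +
      (Finset.univ.filter fun x => Γ.Adj w x ∧ Γ.dist v x = 2).card +
      (Finset.univ.filter fun x => Γ.Adj w x ∧ ¬ Γ.Adj v x ∧ ¬ Γ.dist v x = 2).card = p := by
    rw [← card_filter_adj hreg w, ← Finset.card_union_of_disjoint,
      ← Finset.card_union_of_disjoint]
    · congr 1
      ext x
      have hx := (dist_eq_two_iff_exists Γ v x).1
      simp only [Finset.mem_union, Finset.mem_filter, Finset.mem_univ, true_and]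
      tauto
    · rw [Finset.disjoint_left]
      intro x hx hx'
      simp only [Finset.mem_union, Finset.mem_filter, Finset.mem_univ, true_and] at hx hx'
      tauto
    · rw [Finset.disjoint_left]
      intro x hx hx'
      have := (dist_eq_two_iff_exists Γ v x).1
      simp only [Finset.mem_filter, Finset.mem_univ, true_and] at hx hx'
      tauto
  have hcpos : 0 < (Finset.univ.filter fun x => Γ.Adj v x ∧ Γ.Adj w x).card :=
    Finset.card_pos.2 ⟨u, by simp [hg.1, hg.2.1.symm]⟩
  generalize (Finset.univ.filter fun x => Γ.Adj v x ∧ Γ.Adj w x).card = c at *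
  generalize (Finset.univ.filter fun x => Γ.Adj w x ∧ Γ.dist v x = 2).card = a at *
  generalize (Finset.univ.filter fun x => Γ.dist v x = 2).card = k at *
  generalize (Finset.univ.filter fun x => Γ.Adj w x ∧ ¬ Γ.Adj v x ∧ ¬ Γ.dist v x = 2).card = b
    at *
  generalize (Finset.univ.filter fun x => Γ.Adj u x ∧ (v ≠ x ∧ ¬ Γ.Adj v x) ∧
        (w ≠ x ∧ ¬ Γ.Adj w x)).card = l at *
  have hcm : c ∣ m := by
    have hcop : Nat.Coprime c p := ((Nat.Prime.coprime_iff_not_dvd hp).2 (Nat.not_dvd_of_pos_of_lt hcpos hclt)).symm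
    exact hcop.dvd_of_dvd_mul_left ⟨k, by rw [hcount, mul_comm]⟩
  have hcle := Nat.le_of_dvd hmpos hcm
  have hm2 : 2 * m = p - 1 := by
    obtain ⟨j, hj⟩ := hdvd
    have hj1 : 1 < j := by
      by_contra! hj1
      have : m * j ≤ m * 1 := Nat.mul_le_mul_left m hj1
      omega
    have hj3 : j < 3 := by
      by_contra! hj3
      have : m * 3 ≤ m * j := Nat.mul_le_mul_left m hj3
      omega
    obtain rfl : j = 2 := by omega
    omega
  have hl := hhalf hm2
  have hc : m = c := by
    obtain ⟨j, hj⟩ := hcm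
    have hj2 : j < 2 := by
      by_contra! hj2
      have : c * 2 ≤ c * j := Nat.mul_le_mul_left c hj2
      omega
    interval_cases j <;> omega
  subst hc
  have hk : p = k := Nat.eq_of_mul_eq_mul_right hmpos hcount
  subst hk
  have hodd : ¬ Even p := by
    rw [Nat.not_even_iff]
    omega
  have ha := (Nat.even_mul.1 heven).resolve_left hodd
  have hm' := (Nat.even_mul.1 hmeven).resolve_left hodd
  have hb := hfar rfl
  rw [Nat.even_iff] at ha hm'
  omega

end Global

theorem stmt9 {V : Type*} [Fintype V] (Γ : SimpleGraph V) (p : ℕ)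
    (hp : p.Prime)
    (hreg : ∀ v : V, Nat.card (Γ.neighborSet v) = p)
    (hconn : Γ.Connected)
    (hnc : Γ ≠ ⊤)
    (h2gt : TwoGeodesicTransitive Γ)
    (h2at : ¬ TwoArcTransitive Γ) :
    ∀ v u w : V, Is2Geodesic Γ v u w →
      Nat.card {x : V | Γ.Adj w x ∧ Γ.dist v x = 2} = (p - 1) / 2 := by
  intro v u w hg
  classical
  have := Fact.mk hp
  rw [← card_adj_dist_two hreg h2gt h2at hg, Nat.card_eq_fintype_card, Fintype.card_subtype]
  congr
end
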